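/- arXiv:math/0502295 — 2 statements merged into one kernel-verified Lean document; each statement's English description precedes it below -/
import Mathlib

section
/- The inclusion of a configuration space into its Fulton–MacPherson compactification is a homotopy equivalence: let M be a compact smooth submanifold of ℝ^N, let k ≥ 1, and let F(k,M) ⊂ M^k be the space of k-tuples of pairwise distinct points of M. Define α : F(k,M) → M^k × (S^{N−1})^P × [0,∞]^T, where P is the set of ordered pairs (i,j) of distinct indices in {1,…,k}, T is the set of ordered triples (i,j,l) of pairwise distinct indices, and [0,∞] is the one-point compactification of [0,∞), by α(x) = ( x, ((x_j − x_i)/‖x_j − x_i‖)_{(i,j)∈P}, (‖x_i − x_j‖/‖x_i − x_l‖)_{(i,j,l)∈T} ). Let F[k,M] be the closure of α(F(k,M)) in this product. Then the corestriction of α, viewed as a map F(k,M) → F[k,M], is a homotopy equivalence of topological spaces. -/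
open scoped Classical Topology ENNReal

/-- Euclidean space `ℝᴺ`. -/
abbrev EN (N : ℕ) := EuclideanSpace ℝ (Fin N)

/-- `M` is a smooth (`C^∞`) `d`-dimensional submanifold of `ℝᴺ`: around each of its
points there is a smooth diffeomorphism of open sets of `ℝᴺ` flattening `M` onto the
coordinate subspace `ℝᵈ × {0}`. -/
def IsSmoothSubmanifold (N d : ℕ) (M : Set (EN N)) : Prop :=
  ∀ x ∈ M, ∃ φ : PartialHomeomorph (EN N) (EN N),
    x ∈ φ.source ∧ IsOpen φ.source ∧
    ContDiffOn ℝ (⊤ : ℕ∞) φ φ.source ∧ ContDiffOn ℝ (⊤ : ℕ∞) φ.symm φ.target ∧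
    ∀ y ∈ φ.source, (y ∈ M ↔ ∀ i : Fin N, d ≤ (i : ℕ) → φ y i = 0)

/-- The configuration space `F(k, M)` of `k`-tuples of pairwise distinct points of `M`. -/
def Conf (N k : ℕ) (M : Set (EN N)) : Type :=
  {x : Fin k → EN N // (∀ i, x i ∈ M) ∧ Function.Injective x}

noncomputable instance (N k : ℕ) (M : Set (EN N)) : TopologicalSpace (Conf N k M) :=
  instTopologicalSpaceSubtype

/-- Ordered pairs of distinct indices. -/
def Pairs (k : ℕ) := {p : Fin k × Fin k // p.1 ≠ p.2}

/-- Ordered triples of pairwise distinct indices. -/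
def Triples (k : ℕ) :=
  {t : Fin k × Fin k × Fin k // t.1 ≠ t.2.1 ∧ t.1 ≠ t.2.2 ∧ t.2.1 ≠ t.2.2}

/-- The ambient space `Mᵏ × (S^{N-1})^P × [0,∞]^T` of the Fulton–MacPherson
compactification; `[0,∞]` is realized as `ℝ≥0∞`, the one-point compactification
of `[0,∞)`. -/
abbrev FMTarget (N k : ℕ) :=
  (Fin k → EN N) × (Pairs k → Metric.sphere (0 : EN N) 1) × (Triples k → ℝ≥0∞)

/-- The embedding `α` of `F(k, M)` recording the points, the unit directions
`(xⱼ − xᵢ)/‖xⱼ − xᵢ‖`, and the ratios `‖xᵢ − xⱼ‖/‖xᵢ − xₗ‖`. -/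
noncomputable def fmMap (N k : ℕ) (M : Set (EN N)) (x : Conf N k M) : FMTarget N k :=
  ⟨x.1,
   fun p =>
     ⟨‖x.1 p.1.2 - x.1 p.1.1‖⁻¹ • (x.1 p.1.2 - x.1 p.1.1), by
       have hne : x.1 p.1.2 - x.1 p.1.1 ≠ 0 :=
         sub_ne_zero_of_ne fun hEq => p.2 ((x.2.2 hEq).symm)
       rw [mem_sphere_zero_iff_norm]
       exact norm_smul_inv_norm hne⟩,
   fun t => ENNReal.ofReal (‖x.1 t.1.1 - x.1 t.1.2.1‖ / ‖x.1 t.1.1 - x.1 t.1.2.2‖)⟩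

/-- The Fulton–MacPherson compactification `F[k, M]`: the closure of the image of
`F(k, M)` in `Mᵏ × (S^{N-1})^P × [0,∞]^T`. -/
def FMSpace (N k : ℕ) (M : Set (EN N)) : Set (FMTarget N k) :=
  closure (Set.range (fmMap N k M))


namespace FMAux

/-! ### Local retractions onto the submanifold -/

/-- The derivative of a chart is onto, hence a chart is open. -/
theorem target_mem_nhds {N : ℕ} (φ : PartialHomeomorph (EN N) (EN N)) (ho : IsOpen φ.source)
    (h1 : ContDiffOn ℝ (⊤ : ℕ∞) φ φ.source) (h2 : ContDiffOn ℝ (⊤ : ℕ∞) φ.symm φ.target) :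
    IsOpen φ.target := by
  rw [isOpen_iff_mem_nhds]
  intro y hy
  have hx : φ.symm y ∈ φ.source := φ.toPartialEquiv.map_target hy
  have hxy : φ (φ.symm y) = y := φ.toPartialEquiv.right_inv hy
  set x := φ.symm y with hxdef
  have hs : HasStrictFDerivAt φ (fderiv ℝ φ x) x :=
    (h1.contDiffAt (ho.mem_nhds hx)).hasStrictFDerivAt (by simp)
  have hsymm : DifferentiableWithinAt ℝ φ.symm φ.target y :=
    (h2.differentiableOn (by simp)) y hy
  have hd := hsymm.hasFDerivWithinAt
  rw [← hxy] at hd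
  have hcomp := hd.comp x hs.hasFDerivAt.hasFDerivWithinAt
    (fun z hz => φ.toPartialEquiv.map_source hz : Set.MapsTo φ φ.source φ.target)
  have hid : HasFDerivWithinAt (φ.symm ∘ φ) (ContinuousLinearMap.id ℝ (EN N)) φ.source x := by
    refine (hasFDerivWithinAt_id x φ.source).congr (fun z hz => ?_) ?_
    · exact φ.toPartialEquiv.left_inv hz
    · exact φ.toPartialEquiv.left_inv hx
  have huniq := (ho.uniqueDiffWithinAt hx : UniqueDiffWithinAt ℝ φ.source x).eq hcomp hid
  have hinj : Function.Injective (fderiv ℝ φ x : EN N →ₗ[ℝ] EN N) := by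
    intro v w hvw
    have hv := congrArg (fun L : EN N →L[ℝ] EN N => L v) huniq
    have hw := congrArg (fun L : EN N →L[ℝ] EN N => L w) huniq
    simp only [ContinuousLinearMap.comp_apply, ContinuousLinearMap.id_apply] at hv hw
    rw [← hv, ← hw]
    exact congrArg _ hvw
  have hsurj : Function.Surjective (fderiv ℝ φ x : EN N →ₗ[ℝ] EN N) :=
    LinearMap.surjective_of_injective hinj
  have hmap := hs.map_nhds_eq_of_surj (LinearMap.range_eq_top.2 hsurj)
  rw [hxy] at hmap
  rw [← hmap]
  exact Filter.mem_map.2 (Filter.mem_of_superset (ho.mem_nhds hx)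
    (fun z hz => φ.toPartialEquiv.map_source hz))

/-- Projection to the first `d` coordinates. -/
noncomputable def coordProj (N d : ℕ) (x : EN N) : EN N :=
  WithLp.toLp 2 (fun i => if d ≤ (i : ℕ) then 0 else x i)

theorem contDiff_coordProj (N d : ℕ) : ContDiff ℝ 1 (coordProj N d) := by
  rw [contDiff_euclidean]
  intro i
  by_cases h : d ≤ (i : ℕ)
  · simp only [coordProj, h, if_true]; exact contDiff_const
  · simp only [coordProj, h, if_false]; fun_prop

/-- A submanifold is locally a `C¹` retract. -/
theorem exists_local_retraction {N d : ℕ} {M : Set (EN N)} (hM : IsSmoothSubmanifold N d M)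
    (x : EN N) (hx : x ∈ M) :
    ∃ (V : Set (EN N)) (π : EN N → EN N), IsOpen V ∧ x ∈ V ∧ ContDiffOn ℝ 1 π V ∧
      (∀ y ∈ V, π y ∈ M) ∧ ∀ y ∈ V, y ∈ M → π y = y := by
  obtain ⟨φ, hxs, ho, h1, h2, h3⟩ := hM x hx
  have ht := target_mem_nhds φ ho h1 h2
  have hcont : ContinuousOn (fun y => coordProj N d (φ y)) φ.source :=
    (contDiff_coordProj N d).continuous.comp_continuousOn h1.continuousOn
  have hfix : ∀ y ∈ φ.source, y ∈ M → coordProj N d (φ y) = φ y := by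
    intro y hy hyM
    have := (h3 y hy).1 hyM
    ext i
    by_cases h : d ≤ (i : ℕ)
    · simp [coordProj, h, this i h]
    · simp [coordProj, h]
  refine ⟨φ.source ∩ (fun y => coordProj N d (φ y)) ⁻¹' φ.target,
    fun y => φ.symm (coordProj N d (φ y)), hcont.isOpen_inter_preimage ho ht, ⟨hxs, ?_⟩, ?_, ?_, ?_⟩
  · show coordProj N d (φ x) ∈ φ.target
    rw [hfix x hxs hx]
    exact φ.toPartialEquiv.map_source hxs
  · have e1 : ContDiffOn ℝ 1 φ φ.source := h1.of_le (by exact_mod_cast le_top)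
    have e2 : ContDiffOn ℝ 1 φ.symm φ.target := h2.of_le (by exact_mod_cast le_top)
    exact e2.comp (((contDiff_coordProj N d).comp_contDiffOn e1).mono Set.inter_subset_left)
      (fun y hy => hy.2)
  · intro y hy
    have hs : φ.symm (coordProj N d (φ y)) ∈ φ.source := φ.toPartialEquiv.map_target hy.2
    rw [h3 _ hs]
    intro i hi
    have : φ (φ.symm (coordProj N d (φ y))) = coordProj N d (φ y) :=
      φ.toPartialEquiv.right_inv hy.2
    rw [this]
    simp [coordProj, hi]
  · intro y hy hyM
    show φ.symm (coordProj N d (φ y)) = y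
    rw [hfix y hy.1 hyM]
    exact φ.toPartialEquiv.left_inv hy.1

/-! ### Difference quotients -/

/-- Difference quotient of `π`, completed by the derivative at `σ = 0`. -/
noncomputable def dq {E : Type*} [NormedAddCommGroup E] [NormedSpace ℝ E] (π : E → E)
    (w : E × ℝ × E) : E :=
  if w.2.1 = 0 then fderiv ℝ π w.1 w.2.2 else w.2.1⁻¹ • (π (w.1 + w.2.1 • w.2.2) - π w.1)

theorem smul_dq {E : Type*} [NormedAddCommGroup E] [NormedSpace ℝ E] (π : E → E)
    (w : E × ℝ × E) : w.2.1 • dq π w = π (w.1 + w.2.1 • w.2.2) - π w.1 := by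
  unfold dq
  split_ifs with h
  · simp [h]
  · rw [smul_smul, mul_inv_cancel₀ h, one_smul]

theorem continuousAt_dq {E : Type*} [NormedAddCommGroup E] [NormedSpace ℝ E] {π : E → E}
    {V : Set E} (hV : IsOpen V) (hπ : ContDiffOn ℝ 1 π V) (w : E × ℝ × E) (h1 : w.1 ∈ V)
    (h2 : w.1 + w.2.1 • w.2.2 ∈ V) : ContinuousAt (dq π) w := by
  have hc : ∀ y ∈ V, ContDiffAt ℝ 1 π y := fun y hy => hπ.contDiffAt (hV.mem_nhds hy)
  obtain ⟨z₀, σ₀, u₀⟩ := w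
  simp only at h1 h2
  by_cases hσ : σ₀ = 0
  · subst hσ
    have hst : HasStrictFDerivAt π (fderiv ℝ π z₀) z₀ :=
      (hc z₀ h1).hasStrictFDerivAt (by simp)
    have hfc : ContinuousAt (fderiv ℝ π) z₀ :=
      ((hπ.continuousOn_fderiv_of_isOpen hV (by simp)).continuousAt (hV.mem_nhds h1))
    have key : Filter.Tendsto (fun w : E × ℝ × E => dq π w - fderiv ℝ π z₀ w.2.2)
        (𝓝 (z₀, (0 : ℝ), u₀)) (𝓝 0) := by
      have hlit : (fun w : E × ℝ × E => dq π w - fderiv ℝ π z₀ w.2.2)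
          =o[𝓝 (z₀, (0 : ℝ), u₀)] (fun w : E × ℝ × E => w.2.2) := by
        rw [Asymptotics.isLittleO_iff]
        intro c hcpos
        have e1 := (Asymptotics.isLittleO_iff.1 hst.isLittleO) hcpos
        have ht : Filter.Tendsto (fun w : E × ℝ × E => (w.1 + w.2.1 • w.2.2, w.1))
            (𝓝 (z₀, (0 : ℝ), u₀)) (𝓝 (z₀, z₀)) := by
          have : Continuous (fun w : E × ℝ × E => (w.1 + w.2.1 • w.2.2, w.1)) := by fun_prop
          have h := this.tendsto (z₀, (0 : ℝ), u₀)
          simpa using h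
        have e1' := ht.eventually e1
        have e2 : ∀ᶠ w : E × ℝ × E in 𝓝 (z₀, (0 : ℝ), u₀),
            ‖fderiv ℝ π w.1 - fderiv ℝ π z₀‖ < c := by
          have hcomp : ContinuousAt (fun w : E × ℝ × E => ‖fderiv ℝ π w.1 - fderiv ℝ π z₀‖)
              (z₀, (0 : ℝ), u₀) :=
            ((ContinuousAt.comp (g := fderiv ℝ π) (f := fun w : E × ℝ × E => w.1)
              hfc continuousAt_fst).sub continuousAt_const).norm
          refine hcomp.eventually_lt continuousAt_const ?_
          simpa using hcpos
        filter_upwards [e1', e2] with w hw1 hw2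
        unfold dq
        split_ifs with h
        · rw [← sub_apply]
          exact (ContinuousLinearMap.le_opNorm _ _).trans
            (mul_le_mul_of_nonneg_right hw2.le (norm_nonneg _))
        · have hpos : 0 < |w.2.1| := abs_pos.2 h
          have : w.2.1⁻¹ • (π (w.1 + w.2.1 • w.2.2) - π w.1) - fderiv ℝ π z₀ w.2.2
              = w.2.1⁻¹ • (π (w.1 + w.2.1 • w.2.2) - π w.1
                - fderiv ℝ π z₀ (w.1 + w.2.1 • w.2.2 - w.1)) := by
            rw [smul_sub _ (π (w.1 + w.2.1 • w.2.2) - π w.1), add_sub_cancel_left, map_smul,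
              smul_smul, inv_mul_cancel₀ h, one_smul]
          rw [this, norm_smul, norm_inv, Real.norm_eq_abs]
          simp only [add_sub_cancel_left, norm_smul, Real.norm_eq_abs] at hw1 ⊢
          rw [inv_mul_le_iff₀ hpos]
          calc _ ≤ _ := hw1
            _ = _ := by ring
      have hO : (fun w : E × ℝ × E => w.2.2) =O[𝓝 (z₀, (0 : ℝ), u₀)] (fun _ => (1 : ℝ)) :=
        ((continuous_snd.comp continuous_snd).tendsto (z₀, (0 : ℝ), u₀)).isBigO_one ℝ
      exact (Asymptotics.isLittleO_one_iff ℝ).1 (hlit.trans_isBigO hO)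
    have h2' : Filter.Tendsto (fun w : E × ℝ × E => fderiv ℝ π z₀ w.2.2)
        (𝓝 (z₀, (0 : ℝ), u₀)) (𝓝 (fderiv ℝ π z₀ u₀)) :=
      ((fderiv ℝ π z₀).continuous.comp (continuous_snd.comp continuous_snd)).tendsto
        (z₀, (0 : ℝ), u₀)
    have := key.add h2'
    simp only [sub_add_cancel, zero_add] at this
    have hval : dq π (z₀, (0 : ℝ), u₀) = fderiv ℝ π z₀ u₀ := by simp [dq]
    unfold ContinuousAt
    rwa [hval]
  · have hev : (fun w : E × ℝ × E => w.2.1⁻¹ • (π (w.1 + w.2.1 • w.2.2) - π w.1))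
        =ᶠ[𝓝 (z₀, σ₀, u₀)] dq π := by
      have : ∀ᶠ w : E × ℝ × E in 𝓝 (z₀, σ₀, u₀), w.2.1 ≠ 0 :=
        (continuous_fst.comp continuous_snd).continuousAt.eventually_ne hσ
      filter_upwards [this] with w hw
      simp [dq, hw]
    refine ContinuousAt.congr ?_ hev
    have c1 : ContinuousAt (fun w : E × ℝ × E => w.2.1⁻¹) (z₀, σ₀, u₀) :=
      ContinuousAt.inv₀ (by fun_prop) hσ
    have c2 : ContinuousAt (fun w : E × ℝ × E => π w.1) (z₀, σ₀, u₀) :=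
      ContinuousAt.comp (g := π) (f := fun w : E × ℝ × E => w.1)
        (hc z₀ h1).continuousAt continuousAt_fst
    have c3 : ContinuousAt (fun w : E × ℝ × E => π (w.1 + w.2.1 • w.2.2)) (z₀, σ₀, u₀) :=
      ContinuousAt.comp (g := π) (f := fun w : E × ℝ × E => w.1 + w.2.1 • w.2.2)
        (hc _ h2).continuousAt (by fun_prop)
    exact c1.smul (c3.sub c2)

end FMAux


namespace FMAux

/-! ### Globalizing local pushes -/

/-- A homotopy starting at the identity and not increasing the rank. -/
structure GoodHtpy {X : Type*} [TopologicalSpace X] (rk : X → ℕ) (H : X × unitInterval → X) :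
    Prop where
  cont : Continuous H
  zero : ∀ x, H (x, 0) = x
  le : ∀ x t, rk (H (x, t)) ≤ rk x

/-- A local push near `p`. -/
def HasLocalPush {X : Type*} [TopologicalSpace X] (rk : X → ℕ) (p : X) : Prop :=
  ∃ (W : Set X) (ε : ℝ) (Φ : X × ℝ → X), IsOpen W ∧ p ∈ W ∧ 0 < ε ∧
    ContinuousOn Φ (W ×ˢ Set.Icc 0 ε) ∧ (∀ q ∈ W, Φ (q, 0) = q) ∧
    (∀ q ∈ W, ∀ s ∈ Set.Icc 0 ε, rk (Φ (q, s)) ≤ rk q) ∧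
    (∀ q ∈ W, ∀ s ∈ Set.Ioc 0 ε, rk (Φ (q, s)) < rk p)

theorem GoodHtpy.id {X : Type*} [TopologicalSpace X] (rk : X → ℕ) :
    GoodHtpy rk (fun z : X × unitInterval => z.1) :=
  ⟨continuous_fst, fun _ => rfl, fun _ _ => le_rfl⟩

theorem GoodHtpy.comp {X : Type*} [TopologicalSpace X] {rk : X → ℕ} {H K : X × unitInterval → X}
    (hK : GoodHtpy rk K) (hH : GoodHtpy rk H) :
    GoodHtpy rk (fun z : X × unitInterval => K (H z, z.2)) :=
  ⟨hK.cont.comp (hH.cont.prodMk continuous_snd), fun x => by rw [hH.zero, hK.zero],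
    fun x t => (hK.le _ _).trans (hH.le _ _)⟩

theorem GoodHtpy.scale {X : Type*} [TopologicalSpace X] {rk : X → ℕ} {H : X × unitInterval → X}
    (hH : GoodHtpy rk H) (τ : unitInterval) :
    GoodHtpy rk (fun z : X × unitInterval => H (z.1, τ * z.2)) :=
  ⟨hH.cont.comp (continuous_fst.prodMk (continuous_const.mul continuous_snd)),
    fun x => by rw [mul_zero, hH.zero], fun x t => hH.le _ _⟩

theorem HasLocalPush.exists_good {X : Type*} [TopologicalSpace X] [CompactSpace X] [T2Space X]
    {rk : X → ℕ} {p : X} (h : HasLocalPush rk p) :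
    ∃ H : X × unitInterval → X, GoodHtpy rk H ∧ ∃ O : Set X, IsOpen O ∧ p ∈ O ∧
      ∀ q ∈ O, ∀ t : unitInterval, 0 < t → rk (H (q, t)) < rk p := by
  obtain ⟨W, ε, Φ, hWo, hpW, hε, hΦ, h0, hle, hlt⟩ := h
  obtain ⟨K, hKn, hKc, hKW⟩ := exists_mem_nhds_isClosed_subset (hWo.mem_nhds hpW)
  obtain ⟨χ, hχs, hχ1, hχI⟩ := exists_tsupport_one_of_isOpen_isClosed hWo
    (isClosed_closure.isCompact) hKc hKW
  have hmem : ∀ (q : X) (t : unitInterval), ε * t * χ q ∈ Set.Icc 0 ε := by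
    intro q t
    have h1 := hχI q
    have h2 := t.2
    constructor
    · exact mul_nonneg (mul_nonneg hε.le h2.1) h1.1
    · calc ε * t * χ q ≤ ε * 1 * 1 := by
            refine mul_le_mul (mul_le_mul_of_nonneg_left h2.2 hε.le) h1.2 h1.1 (by linarith)
        _ = ε := by ring
  refine ⟨fun z => if z.1 ∈ W then Φ (z.1, ε * z.2 * χ z.1) else z.1, ⟨?_, ?_, ?_⟩,
    interior K, isOpen_interior, mem_interior_iff_mem_nhds.2 hKn, ?_⟩
  · rw [continuous_iff_continuousAt]
    rintro ⟨q, t⟩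
    by_cases hq : q ∈ W
    · have hopen : (W ×ˢ (Set.univ : Set unitInterval)) ∈ 𝓝 (q, t) :=
        (hWo.prod isOpen_univ).mem_nhds ⟨hq, trivial⟩
      refine ContinuousOn.continuousAt ?_ hopen
      have : ContinuousOn (fun z : X × unitInterval => Φ (z.1, ε * z.2 * χ z.1))
          (W ×ˢ (Set.univ : Set unitInterval)) := by
        refine hΦ.comp (Continuous.continuousOn (by fun_prop)) ?_
        rintro ⟨q', t'⟩ hz
        exact ⟨hz.1, hmem q' t'⟩
      refine this.congr ?_
      rintro ⟨q', t'⟩ hz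
      exact if_pos hz.1
    · have hq' : q ∉ tsupport χ := fun hh => hq (hχs hh)
      have hopen : ((tsupport χ)ᶜ ×ˢ (Set.univ : Set unitInterval)) ∈ 𝓝 (q, t) :=
        ((isClosed_tsupport χ).isOpen_compl.prod isOpen_univ).mem_nhds ⟨hq', trivial⟩
      refine ContinuousAt.congr (f := fun z : X × unitInterval => z.1) continuousAt_fst ?_
      filter_upwards [hopen] with z hz
      split_ifs with hzW
      · rw [image_eq_zero_of_notMem_tsupport hz.1, mul_zero, h0 _ hzW]
      · rfl
  · intro x
    simp only [Set.Icc.coe_zero, mul_zero, zero_mul]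
    split_ifs with hx
    · exact h0 x hx
    · rfl
  · intro x t
    simp only
    split_ifs with hx
    · exact hle x hx _ (hmem x t)
    · exact le_rfl
  · intro q hq t ht
    have hqK := interior_subset hq
    have hqW := hKW hqK
    simp only [hqW, if_true]
    refine hlt q hqW _ ⟨?_, (hmem q t).2⟩
    rw [hχ1 hqK]
    have : (0 : ℝ) < t := ht
    simpa using mul_pos hε this

theorem exists_good_of_compact {X : Type*} [TopologicalSpace X] [CompactSpace X] [T2Space X]
    {rk : X → ℕ} (m : ℕ) (C : Set X) (hC : IsCompact C) (hCm : ∀ q ∈ C, rk q = m)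
    (h : ∀ q ∈ C, HasLocalPush rk q) :
    ∃ H : X × unitInterval → X, GoodHtpy rk H ∧ ∀ q ∈ C, rk (H (q, 1)) < m := by
  have main : ∃ H : X × unitInterval → X, GoodHtpy rk H ∧ ∃ O : Set X, IsOpen O ∧ closure C ⊆ O ∧
      ∀ q ∈ O, ∀ t : unitInterval, 0 < t → rk (H (q, t)) < m := by
    refine hC.induction_on (p := fun S => ∃ H : X × unitInterval → X, GoodHtpy rk H ∧
      ∃ O : Set X, IsOpen O ∧ closure S ⊆ O ∧
      ∀ q ∈ O, ∀ t : unitInterval, 0 < t → rk (H (q, t)) < m) ?_ ?_ ?_ ?_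
    · exact ⟨_, GoodHtpy.id rk, ∅, isOpen_empty, by simp, by simp⟩
    · rintro s t hst ⟨H, hH, O, hO, hsO, hlt⟩
      exact ⟨H, hH, O, hO, (closure_mono hst).trans hsO, hlt⟩
    · rintro S₁ S₂ ⟨H₁, hH₁, O₁, hO₁, hS₁, hlt₁⟩ ⟨H₂, hH₂, O₂, hO₂, hS₂, hlt₂⟩
      obtain ⟨u, v, hu, hv, hsu, hv0, huv⟩ := generalized_tube_lemma
        (isClosed_closure (s := S₂)).isCompact (isCompact_singleton (x := (0 : unitInterval)))
        (hO₂.preimage hH₁.cont) (by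
          rintro ⟨q, t⟩ ⟨hq, ht⟩
          have ht' : t = 0 := ht
          subst ht'
          show H₁ (q, 0) ∈ O₂
          rw [hH₁.zero]
          exact hS₂ hq)
      -- a small positive time
      obtain ⟨τ, hτ, hτv⟩ : ∃ τ : unitInterval, 0 < τ ∧ ∀ t ≤ τ, t ∈ v := by
        have hvn : v ∈ 𝓝 (0 : unitInterval) := hv.mem_nhds (hv0 rfl)
        obtain ⟨δ, hδ, hball⟩ := Metric.mem_nhds_iff.1 hvn
        refine ⟨⟨min (δ / 2) 1, by positivity, min_le_right _ _⟩, ?_, ?_⟩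
        · show (0 : ℝ) < min (δ / 2) 1
          positivity
        · intro t ht
          apply hball
          have h1 : (t : ℝ) ≤ min (δ / 2) 1 := ht
          have h2 : (t : ℝ) ≤ δ / 2 := h1.trans (min_le_left _ _)
          rw [Metric.mem_ball, Subtype.dist_eq, Real.dist_eq]
          simp only [Set.Icc.coe_zero, sub_zero, abs_of_nonneg t.2.1]
          linarith
      refine ⟨_, (hH₂.scale τ).comp (hH₁.scale τ), O₁ ∪ u, hO₁.union hu, ?_, ?_⟩
      · rw [closure_union]
        exact Set.union_subset_union hS₁ hsu
      · intro q hq t ht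
        have hpos : 0 < τ * t := by
          have a1 : (0 : ℝ) < τ := hτ
          have a2 : (0 : ℝ) < t := ht
          show (0 : ℝ) < ((τ * t : unitInterval) : ℝ)
          rw [Set.Icc.coe_mul]
          exact mul_pos a1 a2
        rcases hq with hq | hq
        · exact (hH₂.le _ _).trans_lt (hlt₁ q hq _ hpos)
        · refine hlt₂ _ ?_ _ hpos
          exact huv (show (q, τ * t) ∈ u ×ˢ v from ⟨hq, hτv _ unitInterval.mul_le_left⟩)
    · intro q hq
      obtain ⟨H, hH, O, hO, hqO, hlt⟩ := (h q hq).exists_good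
      obtain ⟨K, hKn, hKc, hKO⟩ := exists_mem_nhds_isClosed_subset (hO.mem_nhds hqO)
      refine ⟨K, mem_nhdsWithin_of_mem_nhds hKn, H, hH, O, hO, ?_, ?_⟩
      · rwa [hKc.closure_eq]
      · rwa [hCm q hq] at hlt
  obtain ⟨H, hH, O, _, hCO, hlt⟩ := main
  exact ⟨H, hH, fun q hq => hlt q (hCO (subset_closure hq)) 1 (by exact zero_lt_one)⟩

theorem exists_good_rank_zero {X : Type*} [TopologicalSpace X] [CompactSpace X] [T2Space X]
    {rk : X → ℕ} (B : ℕ) (hB : ∀ x, rk x ≤ B) (hcl : ∀ m, IsClosed {x | m ≤ rk x})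
    (h : ∀ q, 0 < rk q → HasLocalPush rk q) :
    ∃ H : X × unitInterval → X, GoodHtpy rk H ∧ ∀ q, rk (H (q, 1)) = 0 := by
  have key : ∀ n m : ℕ, n + m = B →
      ∃ H : X × unitInterval → X, GoodHtpy rk H ∧ ∀ q, rk (H (q, 1)) ≤ m := by
    intro n
    induction n with
    | zero =>
      intro m hm
      exact ⟨_, GoodHtpy.id rk, fun q => by simpa [← hm] using hB q⟩
    | succ n ih =>
      intro m hm
      obtain ⟨H, hH, hHm⟩ := ih (m + 1) (by omega)
      have hcont : Continuous (fun q => H (q, 1)) := hH.cont.comp (by fun_prop)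
      have hC : IsCompact (Set.range (fun q => H (q, 1)) ∩ {x | m + 1 ≤ rk x}) :=
        (isCompact_range hcont).inter_right (hcl _)
      obtain ⟨K, hK, hKlt⟩ := exists_good_of_compact (m + 1) _ hC
        (by
          rintro _ ⟨⟨q, rfl⟩, hq⟩
          exact le_antisymm (hHm q) hq)
        (by
          rintro _ ⟨⟨q, rfl⟩, hq⟩
          exact h _ (lt_of_lt_of_le (Nat.succ_pos m) hq))
      refine ⟨_, hK.comp hH, fun q => ?_⟩
      by_cases hq : m + 1 ≤ rk (H (q, 1))
      · exact Nat.lt_succ_iff.1 (hKlt _ ⟨⟨q, rfl⟩, hq⟩)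
      · exact (hK.le _ _).trans (by omega)
  obtain ⟨H, hH, h0⟩ := key B 0 (by omega)
  exact ⟨H, hH, fun q => Nat.le_zero.1 (h0 q)⟩

end FMAux


namespace FMAux

/-! ### Coordinates on the Fulton–MacPherson space -/

/-- Direction from `i` to `j` (zero if `i = j`). -/
noncomputable def dir {N k : ℕ} (q : FMTarget N k) (i j : Fin k) : EN N :=
  if h : i ≠ j then (q.2.1 ⟨(i, j), h⟩ : EN N) else 0

/-- The ratio `|x_i - x_j| / |x_i - x_l|`, with the obvious values for `j = i` and `j = l`. -/
noncomputable def rat {N k : ℕ} (q : FMTarget N k) (i j l : Fin k) : ℝ≥0∞ :=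
  if h : i ≠ j ∧ i ≠ l ∧ j ≠ l then q.2.2 ⟨(i, j, l), h⟩ else if j = i then 0 else 1

theorem continuous_dir {N k : ℕ} (i j : Fin k) :
    Continuous (fun q : FMTarget N k => dir q i j) := by
  unfold dir
  split_ifs with h
  · fun_prop
  · exact continuous_const

theorem continuous_rat {N k : ℕ} (i j l : Fin k) :
    Continuous (fun q : FMTarget N k => rat q i j l) := by
  unfold rat
  split_ifs with h
  · fun_prop
  · exact continuous_const
  · exact continuous_const

theorem norm_dir {N k : ℕ} (q : FMTarget N k) {i j : Fin k} (h : i ≠ j) : ‖dir q i j‖ = 1 := by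
  rw [dir, dif_pos h]
  exact mem_sphere_zero_iff_norm.1 (q.2.1 ⟨(i, j), h⟩).2

theorem dir_ne_zero {N k : ℕ} (q : FMTarget N k) {i j : Fin k} (h : i ≠ j) : dir q i j ≠ 0 := by
  intro h0
  have := norm_dir q h
  rw [h0, norm_zero] at this
  exact zero_ne_one this

theorem dir_fmMap {N k : ℕ} {M : Set (EN N)} (x : Conf N k M) (i j : Fin k) :
    dir (fmMap N k M x) i j = ‖x.1 j - x.1 i‖⁻¹ • (x.1 j - x.1 i) := by
  unfold dir
  split_ifs with h
  · rfl
  · rw [not_not] at h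
    simp [h]

theorem conf_ne {N k : ℕ} {M : Set (EN N)} (x : Conf N k M) {i j : Fin k} (h : i ≠ j) :
    0 < ‖x.1 i - x.1 j‖ :=
  norm_pos_iff.2 (sub_ne_zero.2 (fun e => h (x.2.2 e)))

theorem rat_fmMap {N k : ℕ} {M : Set (EN N)} (x : Conf N k M) (i j l : Fin k) (hil : i ≠ l) :
    rat (fmMap N k M x) i j l = ENNReal.ofReal (‖x.1 i - x.1 j‖ / ‖x.1 i - x.1 l‖) := by
  unfold rat
  split_ifs with h h2
  · rfl
  · simp [h2]
  · have hjl : j = l := by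
      by_contra hjl
      exact h ⟨fun e => h2 e.symm, hil, hjl⟩
    rw [hjl, div_self (conf_ne x hil).ne', ENNReal.ofReal_one]

/-- Equalities extend to the closure. -/
theorem eq_of_mem_FMSpace {N k : ℕ} {M : Set (EN N)} {Y : Type*} [TopologicalSpace Y] [T2Space Y]
    {f g : FMTarget N k → Y} {q : FMTarget N k} (hq : q ∈ FMSpace N k M)
    (hf : ContinuousAt f q) (hg : ContinuousAt g q)
    (h : ∀ᶠ q' in 𝓝 q, ∀ x : Conf N k M, fmMap N k M x = q' → f q' = g q') : f q = g q := by
  have : (𝓝[Set.range (fmMap N k M)] q).NeBot := mem_closure_iff_nhdsWithin_neBot.1 hq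
  refine tendsto_nhds_unique_of_eventuallyEq (l := 𝓝[Set.range (fmMap N k M)] q)
    (hf.mono_left nhdsWithin_le_nhds) (hg.mono_left nhdsWithin_le_nhds) ?_
  filter_upwards [mem_nhdsWithin_of_mem_nhds h, self_mem_nhdsWithin] with q' h1 h2
  obtain ⟨x, hx⟩ := h2
  exact h1 x hx

theorem FMSpace_fst_mem {N k : ℕ} {M : Set (EN N)} (hM : IsCompact M) {q : FMTarget N k}
    (hq : q ∈ FMSpace N k M) (i : Fin k) : q.1 i ∈ M := by
  have hcl : IsClosed {q : FMTarget N k | q.1 i ∈ M} := hM.isClosed.preimage (by fun_prop)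
  refine closure_minimal ?_ hcl hq
  rintro _ ⟨x, rfl⟩
  exact x.2.1 i

theorem FMSpace_dir {N k : ℕ} {M : Set (EN N)} {q : FMTarget N k}
    (hq : q ∈ FMSpace N k M) (i j : Fin k) : ‖q.1 j - q.1 i‖ • dir q i j = q.1 j - q.1 i := by
  have hd := continuous_dir (N := N) i j
  refine eq_of_mem_FMSpace (f := fun q => ‖q.1 j - q.1 i‖ • dir q i j)
    (g := fun q => q.1 j - q.1 i) hq (Continuous.continuousAt (by fun_prop))
    (Continuous.continuousAt (by fun_prop)) (Filter.Eventually.of_forall ?_)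
  rintro _ x rfl
  rw [dir_fmMap, smul_smul]
  by_cases h : i = j
  · simp [h]
  · have : ‖x.1 j - x.1 i‖ ≠ 0 := (conf_ne x (fun e => h e.symm)).ne'
    show (‖x.1 j - x.1 i‖ * ‖x.1 j - x.1 i‖⁻¹) • (x.1 j - x.1 i) = _
    rw [mul_inv_cancel₀ this, one_smul]
    rfl

theorem continuousAt_ofReal_div {Z : Type*} [TopologicalSpace Z] {f g : Z → ℝ} {z : Z}
    (hf : ContinuousAt f z) (hg : ContinuousAt g z) (h : 0 < f z ∨ 0 < g z) :
    ContinuousAt (fun w => ENNReal.ofReal (f w) / ENNReal.ofReal (g w)) z := by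
  refine ENNReal.Tendsto.div ((ENNReal.continuous_ofReal.tendsto _).comp hf) ?_
    ((ENNReal.continuous_ofReal.tendsto _).comp hg) (Or.inl ENNReal.ofReal_ne_top)
  rcases h with h | h
  · exact Or.inl (ENNReal.ofReal_pos.2 h).ne'
  · exact Or.inr (ENNReal.ofReal_pos.2 h).ne'

/-- A point of the compactification with distinct points is in the image of `α`. -/
theorem FMSpace_eq_fmMap {N k : ℕ} {M : Set (EN N)} {q : FMTarget N k}
    (hq : q ∈ FMSpace N k M) (x : Conf N k M) (hx : x.1 = q.1) : fmMap N k M x = q := by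
  have hne : ∀ i j, i ≠ j → 0 < ‖q.1 i - q.1 j‖ := fun i j h => by
    rw [← hx]; exact conf_ne x h
  refine Prod.ext hx (Prod.ext ?_ ?_)
  · funext pr
    obtain ⟨⟨i, j⟩, h⟩ := pr
    apply Subtype.ext
    have e := FMSpace_dir hq i j
    have e1 : dir q i j = (q.2.1 ⟨(i, j), h⟩ : EN N) := dif_pos h
    have hn := hne j i (Ne.symm h)
    show ‖x.1 j - x.1 i‖⁻¹ • (x.1 j - x.1 i) = (q.2.1 ⟨(i, j), h⟩ : EN N)
    rw [hx, ← e1, ← e, smul_smul, e, inv_mul_cancel₀ hn.ne', one_smul]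
  · funext t
    obtain ⟨⟨i, j, l⟩, h⟩ := t
    show ENNReal.ofReal (‖x.1 i - x.1 j‖ / ‖x.1 i - x.1 l‖) = q.2.2 ⟨(i, j, l), h⟩
    have hil := hne i l h.2.1
    rw [hx, ENNReal.ofReal_div_of_pos hil]
    refine eq_of_mem_FMSpace
      (f := fun q => ENNReal.ofReal ‖q.1 i - q.1 j‖ / ENNReal.ofReal ‖q.1 i - q.1 l‖)
      (g := fun q => q.2.2 ⟨(i, j, l), h⟩) hq
      (continuousAt_ofReal_div (Continuous.continuousAt (by fun_prop))
        (Continuous.continuousAt (by fun_prop)) (Or.inr hil))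
      (Continuous.continuousAt (by fun_prop)) (Filter.Eventually.of_forall ?_)
    rintro _ x rfl
    exact (ENNReal.ofReal_div_of_pos (conf_ne x h.2.1)).symm

/-- In each finite set of indices there is a farthest one from `a`. -/
theorem exists_farthest {N k : ℕ} {M : Set (EN N)} {p : FMTarget N k} (hp : p ∈ FMSpace N k M)
    (A : Finset (Fin k)) (a : Fin k) (c : Fin k) (hc : c ∈ A) (hca : c ≠ a) :
    ∃ b ∈ A, b ≠ a ∧ ∀ j ∈ A, rat p a j b ≤ 1 := by
  have hcl : IsClosed (⋃ b ∈ A.filter (· ≠ a), ⋂ j ∈ A, {q : FMTarget N k | rat q a j b ≤ 1}) := by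
    refine Set.Finite.isClosed_biUnion (Finset.finite_toSet _) (fun b _ => ?_)
    refine isClosed_biInter (fun j _ => ?_)
    exact isClosed_le (continuous_rat a j b) continuous_const
  have hmem := closure_minimal (s := Set.range (fmMap N k M)) ?_ hcl hp
  · simp only [Set.mem_iUnion, Set.mem_iInter, Finset.mem_filter] at hmem
    obtain ⟨b, ⟨hb, hba⟩, h⟩ := hmem
    exact ⟨b, hb, hba, h⟩
  · rintro _ ⟨x, rfl⟩
    obtain ⟨b, hb, hmax⟩ := Finset.exists_max_image (A.filter (· ≠ a)) (fun j => ‖x.1 a - x.1 j‖)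
      ⟨c, Finset.mem_filter.2 ⟨hc, hca⟩⟩
    simp only [Set.mem_iUnion, Set.mem_iInter]
    refine ⟨b, hb, fun j hj => ?_⟩
    have hba : a ≠ b := (Finset.mem_filter.1 hb).2.symm
    show rat (fmMap N k M x) a j b ≤ 1
    rw [rat_fmMap x a j b hba, ENNReal.ofReal_le_one, div_le_one (conf_ne x hba)]
    by_cases hja : j = a
    · simp [hja]
    · exact hmax j (Finset.mem_filter.2 ⟨hj, hja⟩)

end FMAux


namespace FMAux

/-! ### Expanding a cluster -/

/-- Data of a push: a cluster `A` of indices, a base index `a`, a farthest index `b`, and a local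
retraction `π` defined on `V`. -/
structure PushData (N k : ℕ) where
  A : Finset (Fin k)
  a : Fin k
  b : Fin k
  π : EN N → EN N
  V : Set (EN N)

namespace PushData

variable {N k : ℕ} (P : PushData N k)

/-- Rescaled positions in the cluster. -/
noncomputable def y (q : FMTarget N k) (j : Fin k) : EN N :=
  (rat q P.a j P.b).toReal • dir q P.a j

/-- Size of the cluster. -/
noncomputable def D (q : FMTarget N k) : ℝ := ‖q.1 P.b - q.1 P.a‖

/-- Expanded cluster, before retracting. -/
noncomputable def z (w : FMTarget N k × ℝ) (j : Fin k) : EN N :=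
  w.1.1 P.a + (P.D w.1 + w.2) • P.y w.1 j

/-- New points. -/
noncomputable def x' (w : FMTarget N k × ℝ) (j : Fin k) : EN N :=
  if j ∈ P.A then P.π (P.z w j) else w.1.1 j

noncomputable def σ (w : FMTarget N k × ℝ) (i j : Fin k) : ℝ :=
  ‖P.y w.1 j - P.y w.1 i‖ * (P.D w.1 + w.2)

/-- Unnormalized new directions. -/
noncomputable def G (w : FMTarget N k × ℝ) (i j : Fin k) : EN N :=
  if i ∈ P.A ∧ j ∈ P.A then dq P.π (P.z w i, P.σ w i j, dir w.1 i j)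
  else if i ∉ P.A ∧ j ∉ P.A then dir w.1 i j
  else P.x' w j - P.x' w i

/-- The push. -/
noncomputable def Φ (w : FMTarget N k × ℝ) : FMTarget N k :=
  ⟨P.x' w,
   fun pr => if h : P.G w pr.1.1 pr.1.2 ≠ 0 then
      ⟨‖P.G w pr.1.1 pr.1.2‖⁻¹ • P.G w pr.1.1 pr.1.2, by
        rw [mem_sphere_zero_iff_norm]; exact norm_smul_inv_norm h⟩ else w.1.2.1 pr,
   fun t => if (t.1.1 ∈ P.A ↔ t.1.2.1 ∈ P.A) ∧ (t.1.1 ∈ P.A ↔ t.1.2.2 ∈ P.A) then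
      w.1.2.2 t * ENNReal.ofReal (‖P.G w t.1.1 t.1.2.1‖ / ‖P.G w t.1.1 t.1.2.2‖)
    else ENNReal.ofReal ‖P.x' w t.1.2.1 - P.x' w t.1.1‖ /
      ENNReal.ofReal ‖P.x' w t.1.2.2 - P.x' w t.1.1‖⟩

/-- Admissible data. -/
structure Adm (M : Set (EN N)) : Prop where
  ha : P.a ∈ P.A
  hb : P.b ∈ P.A
  hab : P.a ≠ P.b
  hV : IsOpen P.V
  hπ : ContDiffOn ℝ 1 P.π P.V
  hπM : ∀ x ∈ P.V, P.π x ∈ M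
  hπid : ∀ x ∈ P.V, x ∈ M → P.π x = x

/-- The open set where the push is defined. -/
structure Good (w : FMTarget N k × ℝ) : Prop where
  fin : ∀ j ∈ P.A, rat w.1 P.a j P.b ≠ ∞
  mem1 : ∀ i ∈ P.A, P.z w i ∈ P.V
  mem2 : ∀ i ∈ P.A, ∀ j ∈ P.A, P.z w i + P.σ w i j • dir w.1 i j ∈ P.V
  ne : ∀ i j, i ≠ j → P.G w i j ≠ 0

variable {P} {M : Set (EN N)}

theorem continuousAt_y {q : FMTarget N k} {j : Fin k} (h : rat q P.a j P.b ≠ ∞) :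
    ContinuousAt (fun q => P.y q j) q := by
  unfold y
  have h1 : ContinuousAt (fun q : FMTarget N k => (rat q P.a j P.b).toReal) q :=
    ContinuousAt.comp (g := ENNReal.toReal) (ENNReal.continuousAt_toReal h)
      (continuous_rat _ _ _).continuousAt
  exact h1.smul (continuous_dir _ _).continuousAt

theorem continuous_D : Continuous P.D := by
  unfold D; fun_prop

theorem continuousAt_y' {w : FMTarget N k × ℝ} {j : Fin k} (h : rat w.1 P.a j P.b ≠ ∞) :
    ContinuousAt (fun w : FMTarget N k × ℝ => P.y w.1 j) w :=
  ContinuousAt.comp (g := fun q => P.y q j) (continuousAt_y h) continuousAt_fst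

theorem continuous_D' : Continuous (fun w : FMTarget N k × ℝ => P.D w.1 + w.2) :=
  (continuous_D.comp continuous_fst).add continuous_snd

theorem continuousAt_z {w : FMTarget N k × ℝ} {j : Fin k} (h : rat w.1 P.a j P.b ≠ ∞) :
    ContinuousAt (fun w => P.z w j) w := by
  unfold z
  refine ContinuousAt.add (Continuous.continuousAt (by fun_prop)) ?_
  exact continuous_D'.continuousAt.smul (continuousAt_y' h)

theorem continuousAt_σ {w : FMTarget N k × ℝ} {i j : Fin k} (h : rat w.1 P.a i P.b ≠ ∞)
    (h' : rat w.1 P.a j P.b ≠ ∞) : ContinuousAt (fun w => P.σ w i j) w := by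
  unfold σ
  exact ((continuousAt_y' h').sub (continuousAt_y' h)).norm.mul continuous_D'.continuousAt

theorem continuous_dir' (i j : Fin k) :
    Continuous (fun w : FMTarget N k × ℝ => dir w.1 i j) :=
  (continuous_dir i j).comp continuous_fst

theorem continuousAt_x' (hP : P.Adm M) {w : FMTarget N k × ℝ} (j : Fin k)
    (h : ∀ j ∈ P.A, rat w.1 P.a j P.b ≠ ∞) (h1 : ∀ i ∈ P.A, P.z w i ∈ P.V) :
    ContinuousAt (fun w => P.x' w j) w := by
  unfold x'
  by_cases hj : j ∈ P.A
  · simp only [hj, if_true]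
    exact ContinuousAt.comp (g := P.π) (f := fun w => P.z w j)
      (hP.hπ.continuousOn.continuousAt (hP.hV.mem_nhds (h1 j hj))) (continuousAt_z (h j hj))
  · simp only [hj, if_false]
    exact Continuous.continuousAt (by fun_prop)

theorem continuousAt_G (hP : P.Adm M) {w : FMTarget N k × ℝ} (i j : Fin k)
    (h : ∀ j ∈ P.A, rat w.1 P.a j P.b ≠ ∞) (h1 : ∀ i ∈ P.A, P.z w i ∈ P.V)
    (h2 : ∀ i ∈ P.A, ∀ j ∈ P.A, P.z w i + P.σ w i j • dir w.1 i j ∈ P.V) :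
    ContinuousAt (fun w => P.G w i j) w := by
  unfold G
  by_cases hij : i ∈ P.A ∧ j ∈ P.A
  · simp only [hij, and_self, if_true]
    refine ContinuousAt.comp (g := dq P.π)
      (f := fun w => (P.z w i, P.σ w i j, dir w.1 i j))
      (continuousAt_dq hP.hV hP.hπ _ (h1 i hij.1) (h2 i hij.1 j hij.2)) ?_
    exact (continuousAt_z (h i hij.1)).prodMk ((continuousAt_σ (h i hij.1) (h j hij.2)).prodMk
      (continuous_dir' i j).continuousAt)
  · simp only [hij, if_false]
    by_cases hij' : i ∉ P.A ∧ j ∉ P.A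
    · simp only [hij', not_false_eq_true, and_self, if_true]
      exact (continuous_dir' i j).continuousAt
    · simp only [hij', if_false]
      exact (continuousAt_x' hP j h h1).sub (continuousAt_x' hP i h h1)

theorem Good.eventually (hP : P.Adm M) {w : FMTarget N k × ℝ} (hw : P.Good w) :
    ∀ᶠ w' in 𝓝 w, P.Good w' := by
  have e1 : ∀ᶠ w' in 𝓝 w, ∀ j ∈ P.A, rat w'.1 P.a j P.b ≠ ∞ := by
    rw [Filter.eventually_all_finset]
    intro j hj
    exact ((continuous_rat P.a j P.b).comp continuous_fst).continuousAt.eventually_ne (hw.fin j hj)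
  have e2 : ∀ᶠ w' in 𝓝 w, ∀ i ∈ P.A, P.z w' i ∈ P.V := by
    rw [Filter.eventually_all_finset]
    intro i hi
    exact (continuousAt_z (hw.fin i hi)).eventually_mem (hP.hV.mem_nhds (hw.mem1 i hi))
  have e3 : ∀ᶠ w' in 𝓝 w, ∀ i ∈ P.A, ∀ j ∈ P.A, P.z w' i + P.σ w' i j • dir w'.1 i j ∈ P.V := by
    rw [Filter.eventually_all_finset]
    intro i hi
    rw [Filter.eventually_all_finset]
    intro j hj
    have hc : ContinuousAt (fun w' => P.z w' i + P.σ w' i j • dir w'.1 i j) w :=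
      (continuousAt_z (hw.fin i hi)).add
      ((continuousAt_σ (hw.fin i hi) (hw.fin j hj)).smul (continuous_dir' i j).continuousAt)
    exact hc.eventually_mem (hP.hV.mem_nhds (hw.mem2 i hi j hj))
  have e4 : ∀ᶠ w' in 𝓝 w, ∀ i j, i ≠ j → P.G w' i j ≠ 0 := by
    rw [Filter.eventually_all]
    intro i
    rw [Filter.eventually_all]
    intro j
    by_cases hij : i = j
    · exact Filter.Eventually.of_forall (fun _ hne => absurd hij hne)
    · filter_upwards [(continuousAt_G hP i j hw.fin hw.mem1 hw.mem2).eventually_ne (hw.ne i j hij)]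
        with w' hw' _
      exact hw'
  filter_upwards [e1, e2, e3, e4] with w' h1 h2 h3 h4
  exact ⟨h1, h2, h3, h4⟩

theorem Good.mixed {w : FMTarget N k × ℝ} (hw : P.Good w) {i j : Fin k} (h : ¬(i ∈ P.A ↔ j ∈ P.A)) :
    P.x' w j - P.x' w i ≠ 0 := by
  have hne : i ≠ j := by
    rintro rfl
    exact h Iff.rfl
  have := hw.ne i j hne
  unfold G at this
  rwa [if_neg (fun h' => h ⟨fun _ => h'.2, fun _ => h'.1⟩),
    if_neg (fun h' => h ⟨fun h1 => absurd h1 h'.1, fun h1 => absurd h1 h'.2⟩)] at this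

theorem Good.continuousAt_Φ (hP : P.Adm M) {w : FMTarget N k × ℝ} (hw : P.Good w) :
    ContinuousAt P.Φ w := by
  have hx : ∀ j, ContinuousAt (fun w => P.x' w j) w :=
    fun j => continuousAt_x' hP j hw.fin hw.mem1
  have hG : ∀ i j, ContinuousAt (fun w => P.G w i j) w :=
    fun i j => continuousAt_G hP i j hw.fin hw.mem1 hw.mem2
  unfold Φ
  refine ContinuousAt.prodMk (continuousAt_pi.2 hx)
    (ContinuousAt.prodMk (continuousAt_pi.2 ?_) (continuousAt_pi.2 ?_))
  · rintro ⟨⟨i, j⟩, hij⟩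
    rw [Topology.IsInducing.subtypeVal.continuousAt_iff]
    have hne := hw.ne i j hij
    have hc : ContinuousAt (fun w => ‖P.G w i j‖⁻¹ • P.G w i j) w :=
      ((hG i j).norm.inv₀ (norm_ne_zero_iff.2 hne)).smul (hG i j)
    refine hc.congr ?_
    filter_upwards [(hG i j).eventually_ne hne] with w' hw'
    simp only [Function.comp_apply]
    rw [dif_pos hw']
  · rintro ⟨⟨i, j, l⟩, hij, hil, hjl⟩
    simp only at hij hil hjl ⊢
    by_cases hs : (i ∈ P.A ↔ j ∈ P.A) ∧ (i ∈ P.A ↔ l ∈ P.A)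
    · have hpos : 0 < ‖P.G w i j‖ / ‖P.G w i l‖ :=
        div_pos (norm_pos_iff.2 (hw.ne i j hij)) (norm_pos_iff.2 (hw.ne i l hil))
      have hc : ContinuousAt (fun w => ENNReal.ofReal (‖P.G w i j‖ / ‖P.G w i l‖)) w :=
        ContinuousAt.comp (g := ENNReal.ofReal) ENNReal.continuous_ofReal.continuousAt
          ((hG i j).norm.div (hG i l).norm (norm_ne_zero_iff.2 (hw.ne i l hil)))
      have hc2 : ContinuousAt (fun w : FMTarget N k × ℝ => w.1.2.2 ⟨(i, j, l), hij, hil, hjl⟩ *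
          ENNReal.ofReal (‖P.G w i j‖ / ‖P.G w i l‖)) w :=
        ENNReal.Tendsto.mul (Continuous.continuousAt (by fun_prop))
          (Or.inr ENNReal.ofReal_ne_top) hc (Or.inl (ENNReal.ofReal_pos.2 hpos).ne')
      exact hc2.congr (Filter.Eventually.of_forall (fun w' => (if_pos hs).symm))
    · simp only [hs, if_false]
      refine continuousAt_ofReal_div ((hx j).sub (hx i)).norm ((hx l).sub (hx i)).norm ?_
      by_cases h1 : (i ∈ P.A ↔ j ∈ P.A)
      · have h2 : ¬ (i ∈ P.A ↔ l ∈ P.A) := fun h2 => hs ⟨h1, h2⟩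
        exact Or.inr (norm_pos_iff.2 (hw.mixed h2))
      · exact Or.inl (norm_pos_iff.2 (hw.mixed h1))

theorem y_fmMap (hab : P.a ≠ P.b) (x : Conf N k M) (j : Fin k) :
    P.y (fmMap N k M x) j = (P.D (fmMap N k M x))⁻¹ • (x.1 j - x.1 P.a) := by
  unfold y
  rw [rat_fmMap x _ _ _ hab, dir_fmMap,
    ENNReal.toReal_ofReal (div_nonneg (norm_nonneg _) (norm_nonneg _)), smul_smul]
  have hD : P.D (fmMap N k M x) = ‖x.1 P.a - x.1 P.b‖ := norm_sub_rev _ _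
  rw [hD]
  by_cases hj : j = P.a
  · simp [hj]
  · have hn := (conf_ne x hj).ne'
    rw [norm_sub_rev (x.1 P.a) (x.1 j)]
    congr 1
    field_simp

/-- `x_j = x_a + D y_j`. -/
theorem FMSpace_y (hab : P.a ≠ P.b) {q : FMTarget N k} (hq : q ∈ FMSpace N k M) {j : Fin k}
    (hj : rat q P.a j P.b ≠ ∞) : q.1 P.a + P.D q • P.y q j = q.1 j := by
  refine eq_of_mem_FMSpace (f := fun q => q.1 P.a + P.D q • P.y q j) (g := fun q => q.1 j) hq
    (ContinuousAt.add (Continuous.continuousAt (by fun_prop))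
      (continuous_D.continuousAt.smul (continuousAt_y hj))) (Continuous.continuousAt (by fun_prop))
    (Filter.Eventually.of_forall ?_)
  rintro _ x rfl
  have hn : P.D (fmMap N k M x) ≠ 0 := (conf_ne x hab.symm).ne'
  rw [y_fmMap hab, smul_smul, mul_inv_cancel₀ hn, one_smul]
  exact add_sub_cancel (x.1 P.a) (x.1 j)

/-- `y_j - y_i` points in the direction `u_ij`. -/
theorem FMSpace_y_sub (hab : P.a ≠ P.b) {q : FMTarget N k} (hq : q ∈ FMSpace N k M) {i j : Fin k}
    (hi : rat q P.a i P.b ≠ ∞) (hj : rat q P.a j P.b ≠ ∞) :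
    ‖P.y q j - P.y q i‖ • dir q i j = P.y q j - P.y q i := by
  refine eq_of_mem_FMSpace (f := fun q => ‖P.y q j - P.y q i‖ • dir q i j)
    (g := fun q => P.y q j - P.y q i) hq
    (((continuousAt_y hj).sub (continuousAt_y hi)).norm.smul (continuous_dir i j).continuousAt)
    ((continuousAt_y hj).sub (continuousAt_y hi))
    (Filter.Eventually.of_forall ?_)
  rintro _ x rfl
  have hn : 0 < P.D (fmMap N k M x) := conf_ne x hab.symm
  rw [y_fmMap hab, y_fmMap hab, ← smul_sub, sub_sub_sub_cancel_right, norm_smul, norm_inv,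
    Real.norm_of_nonneg hn.le, mul_smul]
  congr 1
  exact FMSpace_dir (subset_closure ⟨x, rfl⟩) i j

theorem z_eq (hab : P.a ≠ P.b) {w : FMTarget N k × ℝ} (hq : w.1 ∈ FMSpace N k M) {i j : Fin k}
    (hi : rat w.1 P.a i P.b ≠ ∞) (hj : rat w.1 P.a j P.b ≠ ∞) :
    P.z w i + P.σ w i j • dir w.1 i j = P.z w j := by
  have := FMSpace_y_sub hab hq hi hj
  unfold z σ
  rw [mul_comm, mul_smul, this]
  module

/-- Differences of new points of the cluster. -/
theorem x'_sub (hP : P.Adm M) {w : FMTarget N k × ℝ} (hq : w.1 ∈ FMSpace N k M) (hw : P.Good w)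
    {i j : Fin k} (hi : i ∈ P.A) (hj : j ∈ P.A) :
    P.x' w j - P.x' w i = P.σ w i j • P.G w i j := by
  have h := smul_dq P.π (P.z w i, P.σ w i j, dir w.1 i j)
  simp only at h
  rw [z_eq hP.hab hq (hw.fin i hi) (hw.fin j hj)] at h
  unfold G x'
  rw [if_pos hi, if_pos hj, if_pos ⟨hi, hj⟩, h]

/-- New points do not collide more than the old ones. -/
theorem x'_inj (hP : P.Adm M) {w : FMTarget N k × ℝ} (hq : w.1 ∈ FMSpace N k M) (hw : P.Good w)
    (hs : 0 ≤ w.2) {i j : Fin k} (hij : i ≠ j) (h : P.x' w i = P.x' w j) : w.1.1 i = w.1.1 j := by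
  by_cases hm : i ∈ P.A ↔ j ∈ P.A
  · by_cases hi : i ∈ P.A
    · have hj := hm.1 hi
      have e := x'_sub hP hq hw hi hj
      rw [h, sub_self] at e
      have hσ : P.σ w i j = 0 := (smul_eq_zero.1 e.symm).resolve_right (hw.ne i j hij)
      have hDn : 0 ≤ P.D w.1 := norm_nonneg _
      rw [← FMSpace_y hP.hab hq (hw.fin i hi), ← FMSpace_y hP.hab hq (hw.fin j hj)]
      unfold σ at hσ
      rcases mul_eq_zero.1 hσ with h0 | h0
      · rw [sub_eq_zero.1 (norm_eq_zero.1 h0)]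
      · have : P.D w.1 = 0 := by linarith
        rw [this, zero_smul, zero_smul]
    · have hj := fun hj => hi (hm.2 hj)
      unfold x' at h
      rwa [if_neg hi, if_neg hj] at h
  · exact absurd (by rw [h, sub_self]) (hw.mixed hm)

/-- The base point and the farthest point get separated. -/
theorem x'_ab (hP : P.Adm M) {w : FMTarget N k × ℝ} (hq : w.1 ∈ FMSpace N k M) (hw : P.Good w)
    (hs : 0 < w.2) : P.x' w P.a ≠ P.x' w P.b := by
  intro h
  have e := x'_sub hP hq hw hP.ha hP.hb
  rw [h, sub_self] at e
  have hσ : P.σ w P.a P.b = 0 := (smul_eq_zero.1 e.symm).resolve_right (hw.ne _ _ hP.hab)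
  have hDn : 0 ≤ P.D w.1 := norm_nonneg _
  unfold σ at hσ
  rcases mul_eq_zero.1 hσ with h0 | h0
  · have ya : P.y w.1 P.a = 0 := by simp [y, dir]
    have yb : P.y w.1 P.b = dir w.1 P.a P.b := by simp [y, rat, hP.hab.symm]
    rw [ya, yb, sub_zero, norm_dir _ hP.hab] at h0
    exact one_ne_zero h0
  · linarith

theorem x'_mem (hP : P.Adm M) (hM : IsCompact M) {w : FMTarget N k × ℝ}
    (hq : w.1 ∈ FMSpace N k M) (hw : P.Good w) (i : Fin k) : P.x' w i ∈ M := by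
  unfold x'
  split_ifs with hi
  · exact hP.hπM _ (hw.mem1 i hi)
  · exact FMSpace_fst_mem hM hq i

/-- The new configuration. -/
noncomputable def conf (hP : P.Adm M) (hM : IsCompact M) (x : Conf N k M) (s : ℝ) (hs : 0 ≤ s)
    (hw : P.Good (fmMap N k M x, s)) : Conf N k M :=
  ⟨P.x' (fmMap N k M x, s), x'_mem hP hM (subset_closure ⟨x, rfl⟩) hw, fun i j h => by
    by_contra hij
    exact hij (x.2.2 (x'_inj hP (subset_closure ⟨x, rfl⟩) hw hs hij h))⟩

theorem Φ_fmMap (hP : P.Adm M) (hM : IsCompact M) (x : Conf N k M) (s : ℝ) (hs : 0 ≤ s)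
    (hw : P.Good (fmMap N k M x, s)) :
    P.Φ (fmMap N k M x, s) = fmMap N k M (conf hP hM x s hs hw) := by
  set w : FMTarget N k × ℝ := (fmMap N k M x, s) with hwdef
  have hq : w.1 ∈ FMSpace N k M := subset_closure ⟨x, rfl⟩
  have hDpos : 0 < P.D w.1 := conf_ne x hP.hab.symm
  -- scale factors
  have hκ : ∃ κ : Fin k → ℝ, (∀ i, 0 < κ i) ∧ ∀ i j, (i ∈ P.A ↔ j ∈ P.A) →
      P.x' w j - P.x' w i = (‖x.1 j - x.1 i‖ * κ i) • P.G w i j := by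
    refine ⟨fun i => if i ∈ P.A then (P.D w.1)⁻¹ * (P.D w.1 + s) else 1, fun i => ?_,
      fun i j hm => ?_⟩
    · simp only
      split_ifs
      · positivity
      · exact one_pos
    · by_cases hi : i ∈ P.A
      · have hj := hm.1 hi
        rw [x'_sub hP hq hw hi hj]
        simp only [hi, if_true]
        congr 1
        unfold σ
        have e1 : P.y w.1 j - P.y w.1 i = (P.D w.1)⁻¹ • (x.1 j - x.1 i) := by
          rw [hwdef]
          simp only
          rw [y_fmMap hP.hab, y_fmMap hP.hab, ← smul_sub, sub_sub_sub_cancel_right]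
        rw [e1, norm_smul, norm_inv, Real.norm_of_nonneg hDpos.le]
        show (P.D w.1)⁻¹ * ‖x.1 j - x.1 i‖ * (P.D w.1 + s) = _
        ring
      · have hj : j ∉ P.A := fun hj => hi (hm.2 hj)
        simp only [hi, if_false, mul_one]
        unfold x' G
        rw [if_neg hi, if_neg hj, if_neg (fun h => hi h.1), if_pos ⟨hi, hj⟩]
        exact (FMSpace_dir hq i j).symm
  obtain ⟨κ, hκpos, hκ⟩ := hκ
  refine Prod.ext rfl (Prod.ext ?_ ?_)
  · funext pr
    obtain ⟨⟨i, j⟩, hij⟩ := pr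
    simp only at hij
    apply Subtype.ext
    have hne := hw.ne i j hij
    show ((if h : P.G w i j ≠ 0 then _ else _ : Metric.sphere (0 : EN N) 1) : EN N)
      = ‖P.x' w j - P.x' w i‖⁻¹ • (P.x' w j - P.x' w i)
    rw [dif_pos hne]
    show ‖P.G w i j‖⁻¹ • P.G w i j = _
    have hc : ∃ c : ℝ, 0 < c ∧ P.x' w j - P.x' w i = c • P.G w i j := by
      by_cases hm : i ∈ P.A ↔ j ∈ P.A
      · exact ⟨_, mul_pos (conf_ne x hij.symm) (hκpos i), hκ i j hm⟩
      · refine ⟨1, one_pos, ?_⟩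
        rw [one_smul]
        unfold G
        rw [if_neg (fun h' => hm ⟨fun _ => h'.2, fun _ => h'.1⟩),
          if_neg (fun h' => hm ⟨fun h1 => absurd h1 h'.1, fun h1 => absurd h1 h'.2⟩)]
    obtain ⟨c, hc, e⟩ := hc
    rw [e, norm_smul, Real.norm_of_nonneg hc.le, smul_smul]
    congr 1
    field_simp
  · funext t
    obtain ⟨⟨i, j, l⟩, hij, hil, hjl⟩ := t
    simp only at hij hil hjl
    show (if (i ∈ P.A ↔ j ∈ P.A) ∧ (i ∈ P.A ↔ l ∈ P.A) then
        ENNReal.ofReal (‖x.1 i - x.1 j‖ / ‖x.1 i - x.1 l‖) *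
          ENNReal.ofReal (‖P.G w i j‖ / ‖P.G w i l‖)
      else ENNReal.ofReal ‖P.x' w j - P.x' w i‖ / ENNReal.ofReal ‖P.x' w l - P.x' w i‖)
      = ENNReal.ofReal (‖P.x' w i - P.x' w j‖ / ‖P.x' w i - P.x' w l‖)
    rw [norm_sub_rev (P.x' w i) (P.x' w j), norm_sub_rev (P.x' w i) (P.x' w l)]
    split_ifs with hm
    · rw [hκ i j hm.1, hκ i l hm.2, norm_smul, norm_smul, norm_mul, norm_mul, norm_norm, norm_norm,
        Real.norm_of_nonneg (hκpos i).le, norm_sub_rev (x.1 i) (x.1 j),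
        norm_sub_rev (x.1 i) (x.1 l),
        ← ENNReal.ofReal_mul (div_nonneg (norm_nonneg _) (norm_nonneg _))]
      congr 1
      have h1 := (conf_ne x hil.symm).ne'
      have h2 := (hκpos i).ne'
      have h3 := norm_ne_zero_iff.2 (hw.ne i l hil)
      field_simp
    · rw [ENNReal.ofReal_div_of_pos]
      refine norm_pos_iff.2 (sub_ne_zero.2 (fun h => hil ?_))
      exact ((conf hP hM x s hs hw).2.2 h.symm)

theorem Φ_mem (hP : P.Adm M) (hM : IsCompact M) {w : FMTarget N k × ℝ}
    (hq : w.1 ∈ FMSpace N k M) (hw : P.Good w) (hs : 0 ≤ w.2) : P.Φ w ∈ FMSpace N k M := by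
  have hc : ContinuousAt (fun q => P.Φ (q, w.2)) w.1 :=
    ContinuousAt.comp (g := P.Φ) (f := fun q => (q, w.2)) (hw.continuousAt_Φ hP)
      (by fun_prop)
  have hpair : ContinuousAt (fun q : FMTarget N k => (q, w.2)) w.1 := by fun_prop
  have hev : ∀ᶠ q' in 𝓝 w.1, P.Good (q', w.2) := hpair.eventually (hw.eventually hP)
  have : (𝓝[Set.range (fmMap N k M)] w.1).NeBot := mem_closure_iff_nhdsWithin_neBot.1 hq
  refine mem_closure_of_tendsto (hc.mono_left (nhdsWithin_le_nhds (s := Set.range (fmMap N k M))))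
    ?_
  filter_upwards [mem_nhdsWithin_of_mem_nhds hev, self_mem_nhdsWithin] with q' h1 h2
  obtain ⟨x, rfl⟩ := h2
  rw [Φ_fmMap hP hM x w.2 hs h1]
  exact ⟨_, rfl⟩

theorem Φ_zero (hP : P.Adm M) (hM : IsCompact M) {q : FMTarget N k}
    (hq : q ∈ FMSpace N k M) (hw : P.Good (q, 0)) : P.Φ (q, 0) = q := by
  have hpair : ContinuousAt (fun q : FMTarget N k => (q, (0 : ℝ))) q := by fun_prop
  have hev : ∀ᶠ q' in 𝓝 q, P.Good (q', (0 : ℝ)) := hpair.eventually (hw.eventually hP)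
  refine eq_of_mem_FMSpace (f := fun q => P.Φ (q, 0)) (g := fun q => q) hq
    (ContinuousAt.comp (g := P.Φ) (f := fun q => (q, (0 : ℝ))) (hw.continuousAt_Φ hP) hpair)
    continuousAt_id ?_
  filter_upwards [hev] with q' hq'
  rintro x rfl
  rw [Φ_fmMap hP hM x 0 le_rfl hq']
  congr 1
  apply Subtype.ext
  funext j
  show P.x' (fmMap N k M x, 0) j = x.1 j
  unfold x'
  split_ifs with hj
  · have hz : P.z (fmMap N k M x, 0) j = x.1 j := by
      have := FMSpace_y hP.hab (subset_closure ⟨x, rfl⟩ : fmMap N k M x ∈ FMSpace N k M)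
        (hq'.fin j hj)
      unfold z
      rw [add_zero]
      exact this
    have hm := hq'.mem1 j hj
    rw [hz] at hm ⊢
    exact hP.hπid _ hm (x.2.1 j)
  · rfl

/-- At a collision, the derivative of the retraction fixes the directions. -/
theorem dq_dir (hP : P.Adm M) {p : FMTarget N k} (hp : p ∈ FMSpace N k M) {i j : Fin k}
    (hi : p.1 i ∈ P.V) (hj : p.1 j ∈ P.V) (hne : i ≠ j) :
    dq P.π (p.1 i, ‖p.1 j - p.1 i‖, dir p i j) = dir p i j := by
  have hd := continuous_dir (N := N) i j
  have hev1 : ∀ᶠ q : FMTarget N k in 𝓝 p, q.1 i ∈ P.V :=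
    ((by fun_prop : Continuous (fun q : FMTarget N k => q.1 i)).continuousAt).eventually_mem
      (hP.hV.mem_nhds hi)
  have hev2 : ∀ᶠ q : FMTarget N k in 𝓝 p, q.1 j ∈ P.V :=
    ((by fun_prop : Continuous (fun q : FMTarget N k => q.1 j)).continuousAt).eventually_mem
      (hP.hV.mem_nhds hj)
  refine eq_of_mem_FMSpace
    (f := fun q => dq P.π (q.1 i, ‖q.1 j - q.1 i‖, dir q i j)) (g := fun q => dir q i j) hp
    (ContinuousAt.comp (g := dq P.π) (f := fun q : FMTarget N k =>
      (q.1 i, ‖q.1 j - q.1 i‖, dir q i j))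
      (continuousAt_dq hP.hV hP.hπ _ hi ?_) (Continuous.continuousAt (by fun_prop)))
    hd.continuousAt ?_
  · simp only
    rw [FMSpace_dir hp, add_sub_cancel]
    exact hj
  · filter_upwards [hev1, hev2] with q h1 h2
    rintro x rfl
    have hpos : ‖x.1 j - x.1 i‖ ≠ 0 := (conf_ne x hne.symm).ne'
    have e := FMSpace_dir (subset_closure ⟨x, rfl⟩ : fmMap N k M x ∈ FMSpace N k M) i j
    have h := smul_dq P.π ((fmMap N k M x).1 i, ‖(fmMap N k M x).1 j - (fmMap N k M x).1 i‖,
      dir (fmMap N k M x) i j)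
    simp only at h
    rw [e, add_sub_cancel, hP.hπid _ h1 (x.2.1 i), hP.hπid _ h2 (x.2.1 j)] at h
    exact smul_right_injective _ hpos (h.trans e.symm)

end PushData

end FMAux


namespace FMAux

/-! ### The rank and the local pushes -/

/-- The set of collisions. -/
noncomputable def deg {N k : ℕ} (q : FMTarget N k) : Finset (Fin k × Fin k) :=
  Finset.univ.filter (fun ij => ij.1 ≠ ij.2 ∧ q.1 ij.1 = q.1 ij.2)

theorem mem_deg {N k : ℕ} {q : FMTarget N k} {i j : Fin k} :
    (i, j) ∈ deg q ↔ i ≠ j ∧ q.1 i = q.1 j := by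
  simp [deg]

/-- The rank on the compactification: the number of collisions. -/
noncomputable def rk {N k : ℕ} {M : Set (EN N)} (q : FMSpace N k M) : ℕ := (deg q.1).card

theorem eventually_deg_subset {N k : ℕ} (p : FMTarget N k) : ∀ᶠ q in 𝓝 p, deg q ⊆ deg p := by
  have : ∀ᶠ q in 𝓝 p, ∀ i j, p.1 i ≠ p.1 j → q.1 i ≠ q.1 j := by
    rw [Filter.eventually_all]
    intro i
    rw [Filter.eventually_all]
    intro j
    by_cases h : p.1 i = p.1 j
    · exact Filter.Eventually.of_forall (fun _ hne => absurd h hne)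
    · have hc : ContinuousAt (fun q : FMTarget N k => q.1 i - q.1 j) p :=
        Continuous.continuousAt (by fun_prop)
      filter_upwards [hc.eventually_ne (sub_ne_zero.2 h)] with q hq _
      exact sub_ne_zero.1 hq
  filter_upwards [this] with q hq
  rintro ⟨i, j⟩ hij
  rw [mem_deg] at hij ⊢
  refine ⟨hij.1, ?_⟩
  by_contra h
  exact hq i j h hij.2

theorem isClosed_rk {N k : ℕ} {M : Set (EN N)} (m : ℕ) :
    IsClosed {q : FMSpace N k M | m ≤ rk q} := by
  rw [← isOpen_compl_iff, isOpen_iff_mem_nhds]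
  intro q hq
  have h := continuous_subtype_val.continuousAt.eventually (eventually_deg_subset q.1)
  filter_upwards [h] with q' hq' hm
  apply hq
  exact le_trans (show m ≤ rk q' from hm) (Finset.card_le_card hq')

theorem exists_push {N k d : ℕ} {M : Set (EN N)} (hM : IsCompact M)
    (hMs : IsSmoothSubmanifold N d M) {p : FMTarget N k} (hp : p ∈ FMSpace N k M)
    (hdeg : (deg p).Nonempty) :
    ∃ P : PushData N k, P.Adm M ∧ P.Good (p, 0) ∧ (P.a, P.b) ∈ deg p := by
  obtain ⟨⟨a, c⟩, hac⟩ := hdeg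
  rw [mem_deg] at hac
  obtain ⟨hac, hpac⟩ := hac
  obtain ⟨V, π, hV, hxV, hπ, hπM, hπid⟩ :=
    exists_local_retraction hMs (p.1 a) (FMSpace_fst_mem hM hp a)
  set A : Finset (Fin k) := Finset.univ.filter (fun j => p.1 j = p.1 a) with hA
  have memA : ∀ j, j ∈ A ↔ p.1 j = p.1 a := fun j => by simp [hA]
  obtain ⟨b, hbA, hba, hb⟩ := exists_farthest hp A a c ((memA c).2 hpac.symm) hac.symm
  have hpb := (memA b).1 hbA
  let P : PushData N k := ⟨A, a, b, π, V⟩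
  have hP : P.Adm M := ⟨(memA a).2 rfl, hbA, hba.symm, hV, hπ, hπM, hπid⟩
  have hD : P.D p = 0 := by
    show ‖p.1 b - p.1 a‖ = 0
    rw [hpb, sub_self, norm_zero]
  have hz : ∀ i, P.z (p, 0) i = p.1 a := by
    intro i
    show p.1 a + (P.D p + 0) • P.y p i = p.1 a
    rw [hD, add_zero, zero_smul, add_zero]
  have hσ : ∀ i j, P.σ (p, 0) i j = 0 := by
    intro i j
    show _ * (P.D p + 0) = 0
    rw [hD, add_zero, mul_zero]
  have hx' : ∀ i, P.x' (p, 0) i = p.1 i := by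
    intro i
    show (if i ∈ A then π (P.z (p, 0) i) else p.1 i) = p.1 i
    split_ifs with hi
    · rw [hz, (memA i).1 hi]
      exact hπid _ hxV (FMSpace_fst_mem hM hp a)
    · rfl
  refine ⟨P, hP, ⟨?_, ?_, ?_, ?_⟩, mem_deg.2 ⟨hba.symm, hpb.symm⟩⟩
  · intro j hj
    exact ne_top_of_le_ne_top ENNReal.one_ne_top (hb j hj)
  · intro i _
    rw [hz]
    exact hxV
  · intro i _ j _
    rw [hz, hσ, zero_smul, add_zero]
    exact hxV
  · intro i j hij
    show (if i ∈ A ∧ j ∈ A then dq π (P.z (p, 0) i, P.σ (p, 0) i j, dir p i j)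
      else if i ∉ A ∧ j ∉ A then dir p i j else P.x' (p, 0) j - P.x' (p, 0) i) ≠ 0
    split_ifs with h1 h2
    · have hi := (memA i).1 h1.1
      have hj := (memA j).1 h1.2
      have e := PushData.dq_dir hP hp (i := i) (j := j) (by rw [hi]; exact hxV)
        (by rw [hj]; exact hxV) hij
      rw [hi, hj, sub_self, norm_zero] at e
      rw [hz, hσ]
      have e' : dq π (p.1 a, (0 : ℝ), dir p i j) = dir p i j := e
      rw [e']
      exact dir_ne_zero p hij
    · exact dir_ne_zero p hij
    · rw [hx', hx']
      intro h
      have hpij : p.1 j = p.1 i := sub_eq_zero.1 h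
      have : i ∈ A ↔ j ∈ A := by rw [memA, memA, hpij]
      tauto

theorem hasLocalPush {N k d : ℕ} {M : Set (EN N)} (hM : IsCompact M)
    (hMs : IsSmoothSubmanifold N d M) (p : FMSpace N k M) (hpos : 0 < rk p) :
    HasLocalPush rk p := by
  obtain ⟨P, hP, hgood, hab⟩ := exists_push hM hMs p.2 (Finset.card_pos.1 hpos)
  have hfst : Filter.Tendsto (fun w : FMTarget N k × ℝ => w.1) (𝓝 (p.1, (0 : ℝ))) (𝓝 p.1) :=
    continuous_fst.tendsto (p.1, (0 : ℝ))
  have hev : ∀ᶠ w : FMTarget N k × ℝ in 𝓝 (p.1, (0 : ℝ)), P.Good w ∧ deg w.1 ⊆ deg p.1 :=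
    (hgood.eventually hP).and (hfst.eventually (eventually_deg_subset p.1))
  rw [nhds_prod_eq, Filter.eventually_prod_iff] at hev
  obtain ⟨pa, hpa, pb, hpb, hgd⟩ := hev
  obtain ⟨O, hO1, hOo, hpO⟩ := mem_nhds_iff.1 hpa
  obtain ⟨δ, hδ, hball⟩ := Metric.mem_nhds_iff.1 hpb
  have hgd' : ∀ q ∈ O, ∀ s ∈ Set.Icc (0 : ℝ) (δ / 2), P.Good (q, s) ∧ deg q ⊆ deg p.1 := by
    intro q hq s hs
    refine hgd (hO1 hq) (hball ?_)
    rw [Metric.mem_ball, Real.dist_eq, sub_zero, abs_of_nonneg hs.1]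
    linarith [hs.2]
  have hsub : ∀ (q : FMSpace N k M), q.1 ∈ O → ∀ s ∈ Set.Icc (0 : ℝ) (δ / 2),
      deg (P.Φ (q.1, s)) ⊆ deg q.1 := by
    rintro q hq s hs ⟨i, j⟩ hij
    rw [mem_deg] at hij ⊢
    exact ⟨hij.1, PushData.x'_inj hP (w := (q.1, s)) q.2 (hgd' q.1 hq s hs).1 hs.1 hij.1 hij.2⟩
  have hmem : ∀ (q : FMSpace N k M), q.1 ∈ O → ∀ s ∈ Set.Icc (0 : ℝ) (δ / 2),
      P.Φ (q.1, s) ∈ FMSpace N k M := fun q hq s hs =>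
    PushData.Φ_mem hP hM (w := (q.1, s)) q.2 (hgd' q.1 hq s hs).1 hs.1
  let Ψ : FMSpace N k M × ℝ → FMSpace N k M := fun w =>
    if h : P.Φ (w.1.1, w.2) ∈ FMSpace N k M then ⟨_, h⟩ else w.1
  have hΨ : ∀ (q : FMSpace N k M), q.1 ∈ O → ∀ s ∈ Set.Icc (0 : ℝ) (δ / 2),
      (Ψ (q, s)).1 = P.Φ (q.1, s) := by
    intro q hq s hs
    show (dite _ _ _ : FMSpace N k M).1 = _
    rw [dif_pos (hmem q hq s hs)]
  refine ⟨Subtype.val ⁻¹' O, δ / 2, Ψ, hOo.preimage continuous_subtype_val, hpO, by positivity,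
    ?_, ?_, ?_, ?_⟩
  · rw [Topology.IsInducing.subtypeVal.continuousOn_iff]
    have hc : ContinuousOn (fun w : FMSpace N k M × ℝ => P.Φ (w.1.1, w.2))
        ((Subtype.val ⁻¹' O) ×ˢ Set.Icc 0 (δ / 2)) := by
      rintro ⟨q, s⟩ ⟨hq, hs⟩
      refine ContinuousAt.continuousWithinAt ?_
      exact ContinuousAt.comp (g := P.Φ) (f := fun w : FMSpace N k M × ℝ => (w.1.1, w.2))
        ((hgd' q.1 hq s hs).1.continuousAt_Φ hP) (Continuous.continuousAt (by fun_prop))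
    refine hc.congr ?_
    rintro ⟨q, s⟩ ⟨hq, hs⟩
    exact hΨ q hq s hs
  · intro q hq
    have h0 : (0 : ℝ) ∈ Set.Icc (0 : ℝ) (δ / 2) := ⟨le_rfl, by positivity⟩
    apply Subtype.ext
    rw [hΨ q hq 0 h0]
    exact PushData.Φ_zero hP hM q.2 (hgd' q.1 hq 0 h0).1
  · intro q hq s hs
    unfold rk
    rw [hΨ q hq s hs]
    exact Finset.card_le_card (hsub q hq s hs)
  · intro q hq s hs
    have hs' : s ∈ Set.Icc (0 : ℝ) (δ / 2) := ⟨hs.1.le, hs.2⟩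
    unfold rk
    rw [hΨ q hq s hs']
    refine Finset.card_lt_card ⟨(hsub q hq s hs').trans (hgd' q.1 hq s hs').2, fun hcon => ?_⟩
    have h2 := (mem_deg.1 (hcon hab)).2
    exact PushData.x'_ab hP (w := (q.1, s)) q.2 (hgd' q.1 hq s hs').1 hs.1 h2

/-! ### The homotopy equivalence -/

theorem isCompact_FMSpace {N k : ℕ} {M : Set (EN N)} (hM : IsCompact M) :
    IsCompact (FMSpace N k M) := by
  have hc : IsCompact ((Set.univ.pi fun _ : Fin k => M) ×ˢ
      (Set.univ : Set ((Pairs k → Metric.sphere (0 : EN N) 1) × (Triples k → ℝ≥0∞)))) :=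
    (isCompact_univ_pi fun _ => hM).prod isCompact_univ
  refine hc.of_isClosed_subset isClosed_closure ?_
  intro q hq
  exact ⟨fun i _ => FMSpace_fst_mem hM hq i, trivial⟩

theorem continuous_fmMap {N k : ℕ} {M : Set (EN N)} : Continuous (fmMap N k M) := by
  have hv : Continuous (fun x : Conf N k M => x.1) := continuous_subtype_val
  have hvi : ∀ i, Continuous (fun x : Conf N k M => x.1 i) :=
    fun i => (continuous_apply i).comp hv
  unfold fmMap
  refine hv.prodMk (Continuous.prodMk (continuous_pi ?_) (continuous_pi ?_))
  · rintro ⟨⟨i, j⟩, hij⟩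
    have hs := (hvi j).sub (hvi i)
    refine Continuous.subtype_mk ?_ _
    exact (hs.norm.inv₀ (fun x => (conf_ne x (Ne.symm hij)).ne')).smul hs
  · rintro ⟨⟨i, j, l⟩, h⟩
    exact ENNReal.continuous_ofReal.comp
      (((hvi i).sub (hvi j)).norm.div ((hvi i).sub (hvi l)).norm
        (fun x => (conf_ne x h.2.1).ne'))

/-- Points of rank zero are configurations. -/
noncomputable def toConf {N k : ℕ} {M : Set (EN N)} (hM : IsCompact M) (q : FMSpace N k M)
    (h : rk q = 0) : Conf N k M :=
  ⟨q.1.1, FMSpace_fst_mem hM q.2, fun i j hij => by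
    by_contra hne
    have : (i, j) ∈ deg q.1 := mem_deg.2 ⟨hne, hij⟩
    rw [Finset.card_eq_zero.1 h] at this
    simp at this⟩

theorem rk_fmMap {N k : ℕ} {M : Set (EN N)} (x : Conf N k M)
    (h : fmMap N k M x ∈ FMSpace N k M) : rk (⟨fmMap N k M x, h⟩ : FMSpace N k M) = 0 := by
  refine Finset.card_eq_zero.2 (Finset.eq_empty_of_forall_notMem ?_)
  rintro ⟨i, j⟩ hij
  rw [mem_deg] at hij
  exact hij.1 (x.2.2 hij.2)

theorem main {N k d : ℕ} {M : Set (EN N)} (hM : IsCompact M) (hMs : IsSmoothSubmanifold N d M) :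
    ∃ e : ContinuousMap.HomotopyEquiv (Conf N k M) (FMSpace N k M),
      ∀ x : Conf N k M, (e.toFun x : FMTarget N k) = fmMap N k M x := by
  have : CompactSpace (FMSpace N k M) := isCompact_iff_compactSpace.1 (isCompact_FMSpace hM)
  obtain ⟨H, hH, hH1⟩ := exists_good_rank_zero (X := FMSpace N k M) (rk := rk)
    (Fintype.card (Fin k × Fin k)) (fun q => Finset.card_le_univ _) isClosed_rk
    (hasLocalPush hM hMs)
  let f : C(Conf N k M, FMSpace N k M) :=
    ⟨fun x => ⟨fmMap N k M x, subset_closure ⟨x, rfl⟩⟩, continuous_fmMap.subtype_mk _⟩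
  have hH0 : ∀ x t, rk (H (f x, t)) = 0 := fun x t =>
    Nat.le_zero.1 ((hH.le (f x) t).trans (rk_fmMap x _).le)
  let g : C(FMSpace N k M, Conf N k M) :=
    ⟨fun q => toConf hM (H (q, 1)) (hH1 q), by
      refine Continuous.subtype_mk ?_ _
      exact continuous_fst.comp (continuous_subtype_val.comp (hH.cont.comp (by fun_prop)))⟩
  have hfg : ∀ q, f (g q) = H (q, 1) := fun q => by
    apply Subtype.ext
    exact FMSpace_eq_fmMap (H (q, 1)).2 (g q) rfl
  let F1 : ContinuousMap.Homotopy (ContinuousMap.id (Conf N k M)) (g.comp f) :=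
    { toFun := fun z => toConf hM (H (f z.2, z.1)) (hH0 z.2 z.1)
      continuous_toFun := by
        refine Continuous.subtype_mk ?_ _
        exact continuous_fst.comp (continuous_subtype_val.comp
          (hH.cont.comp ((f.continuous.comp continuous_snd).prodMk continuous_fst)))
      map_zero_left := fun x => by
        apply Subtype.ext
        show (H (f x, 0)).1.1 = x.1
        rw [hH.zero]
        rfl
      map_one_left := fun x => rfl }
  let F2 : ContinuousMap.Homotopy (ContinuousMap.id (FMSpace N k M)) (f.comp g) :=
    { toFun := fun z => H (z.2, z.1)
      continuous_toFun := hH.cont.comp (continuous_snd.prodMk continuous_fst)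
      map_zero_left := fun q => hH.zero q
      map_one_left := fun q => (hfg q).symm }
  exact ⟨⟨f, g, ⟨F1.symm⟩, ⟨F2.symm⟩⟩, fun x => rfl⟩

end FMAux


/-- **The inclusion of a configuration space into its Fulton–MacPherson
compactification is a homotopy equivalence** (§3.2 of the paper): for a compact smooth
submanifold `M ⊆ ℝᴺ` and `k ≥ 1`, the corestriction of `α` to `F[k, M]` is a homotopy
equivalence `F(k, M) ≃ F[k, M]`. -/
theorem fm_compactification_homotopy_equivalence
    (N k : ℕ) (hk : 1 ≤ k) (M : Set (EN N)) (hMc : IsCompact M)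
    (hMs : ∃ d : ℕ, IsSmoothSubmanifold N d M) :
    ∃ e : ContinuousMap.HomotopyEquiv (Conf N k M) (FMSpace N k M),
      ∀ x : Conf N k M, (e.toFun x : FMTarget N k) = fmMap N k M x := by
  obtain ⟨d, hd⟩ := hMs
  exact FMAux.main hMc hd
end

section
/- Every knot invariant of finite type 0 is constant: let V be a knot invariant such that V(K⁺) = V(K⁻) whenever K⁺ and K⁻ are the two resolutions of a single transverse double point, i.e., whenever there exist a smooth 1-periodic map F : ℝ → ℝ³ with nowhere-vanishing derivative whose restriction to [0,1) is injective except that F(s) = F(t) for exactly one pair s ≠ t in [0,1) with F'(s) and F'(t) linearly independent, a smooth 1-periodic bump function φ with φ(t) = 1 whose support avoids s modulo 1, and ε > 0, such that K^± = F ± ε·φ·(F'(s) × F'(t)) are both knots. Then V takes the same value on all knots. -/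
open scoped Classical BigOperators Topology

/-- `ℝ³` with its Euclidean norm. -/
abbrev E3 := EuclideanSpace ℝ (Fin 3)

/-- The determinant of the 3×3 matrix with columns `u`, `v`, `w`. -/
def det3 (u v w : E3) : ℝ :=
  u 0 * (v 1 * w 2 - v 2 * w 1) - u 1 * (v 0 * w 2 - v 2 * w 0) +
    u 2 * (v 0 * w 1 - v 1 * w 0)

/-- The cross product on `ℝ³`. -/
noncomputable def cross3 (u v : E3) : E3 :=
  EuclideanSpace.single 0 (u 1 * v 2 - u 2 * v 1) +
  EuclideanSpace.single 1 (u 2 * v 0 - u 0 * v 2) +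
  EuclideanSpace.single 2 (u 0 * v 1 - u 1 * v 0)

/-- A knot: a smooth `1`-periodic map `ℝ → ℝ³` with nowhere-vanishing derivative whose
restriction to `[0,1)` is injective. -/
structure IsKnot (K : ℝ → E3) : Prop where
  smooth : ContDiff ℝ (⊤ : ℕ∞) K
  periodic : Function.Periodic K 1
  injOn : Set.InjOn K (Set.Ico (0 : ℝ) 1)
  deriv_ne : ∀ t, deriv K t ≠ 0

/-- A smooth isotopy between two knots. -/
def KnotIsotopic (K₀ K₁ : ℝ → E3) : Prop :=
  ∃ H : ℝ → ℝ → E3,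
    ContDiff ℝ (⊤ : ℕ∞) (fun p : ℝ × ℝ => H p.1 p.2) ∧
    (∀ t ∈ Set.Icc (0 : ℝ) 1, IsKnot (H t)) ∧
    H 0 = K₀ ∧ H 1 = K₁

/-- A knot invariant: a real-valued function taking equal values on smoothly isotopic
knots. -/
def IsKnotInvariant (V : (ℝ → E3) → ℝ) : Prop :=
  ∀ K₀ K₁ : ℝ → E3, IsKnot K₀ → IsKnot K₁ → KnotIsotopic K₀ K₁ → V K₀ = V K₁

/-- The normalized area `2`-form of `S²` (extended to ambient `ℝ³`):
`ω_u(a, b) = det(u, a, b) / 4π`. -/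
noncomputable def sphereForm (u a b : E3) : ℝ := det3 u a b / (4 * Real.pi)

/-- The space curve with given coordinate functions. -/
noncomputable def mkc (x y z : ℝ → ℝ) : ℝ → E3 := fun t => !₂[x t, y t, z t]

/-- Coordinate version of being a knot. -/
structure Knot3 (x y z : ℝ → ℝ) : Prop where
  cx : ContDiff ℝ (⊤ : ℕ∞) x
  cy : ContDiff ℝ (⊤ : ℕ∞) y
  cz : ContDiff ℝ (⊤ : ℕ∞) z
  px : Function.Periodic x 1
  py : Function.Periodic y 1
  pz : Function.Periodic z 1
  inj : ∀ s t, x s = x t → y s = y t → z s = z t → ∃ m : ℤ, s = t + m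
  imm : ∀ t, deriv x t = 0 → deriv y t = 0 → deriv z t ≠ 0

lemma per_int {x : ℝ → ℝ} (h : Function.Periodic x 1) (t : ℝ) (m : ℤ) : x (t + m) = x t := by
  have := h.int_mul m t
  simpa using this

lemma hasDerivAt_mkc {x y z : ℝ → ℝ} {x' y' z' t : ℝ} (hx : HasDerivAt x x' t)
    (hy : HasDerivAt y y' t) (hz : HasDerivAt z z' t) :
    HasDerivAt (mkc x y z) !₂[x', y', z'] t := by
  have h : HasDerivAt (fun t => (![x t, y t, z t] : Fin 3 → ℝ)) ![x', y', z'] t := by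
    rw [hasDerivAt_pi]
    intro i
    fin_cases i
    · simpa using hx
    · simpa using hy
    · simpa using hz
  exact (PiLp.continuousLinearEquiv 2 ℝ (fun _ : Fin 3 => ℝ)).symm.hasFDerivAt.comp_hasDerivAt t h

lemma smooth_diff {x : ℝ → ℝ} (h : ContDiff ℝ (⊤ : ℕ∞) x) (t : ℝ) : HasDerivAt x (deriv x t) t :=
  (h.differentiable (by simp) t).hasDerivAt

lemma deriv_mkc {x y z : ℝ → ℝ} (hx : ContDiff ℝ (⊤ : ℕ∞) x) (hy : ContDiff ℝ (⊤ : ℕ∞) y)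
    (hz : ContDiff ℝ (⊤ : ℕ∞) z) (t : ℝ) :
    deriv (mkc x y z) t = !₂[deriv x t, deriv y t, deriv z t] :=
  (hasDerivAt_mkc (smooth_diff hx t) (smooth_diff hy t) (smooth_diff hz t)).deriv

lemma mkc_inj {x y z : ℝ → ℝ} {s t : ℝ} (h : mkc x y z s = mkc x y z t) :
    x s = x t ∧ y s = y t ∧ z s = z t := by
  refine ⟨?_, ?_, ?_⟩
  · simpa [mkc] using congrArg (fun v : E3 => v 0) h
  · simpa [mkc] using congrArg (fun v : E3 => v 1) h
  · simpa [mkc] using congrArg (fun v : E3 => v 2) h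

lemma vec_eq_zero {a b c : ℝ} (h : (!₂[a, b, c] : E3) = 0) : a = 0 ∧ b = 0 ∧ c = 0 := by
  refine ⟨?_, ?_, ?_⟩
  · simpa using congrArg (fun v : E3 => v 0) h
  · simpa using congrArg (fun v : E3 => v 1) h
  · simpa using congrArg (fun v : E3 => v 2) h

lemma contDiff_mkc2 {E : Type*} [NormedAddCommGroup E] [NormedSpace ℝ E] {x y z : E → ℝ}
    (hx : ContDiff ℝ (⊤ : ℕ∞) x) (hy : ContDiff ℝ (⊤ : ℕ∞) y)
    (hz : ContDiff ℝ (⊤ : ℕ∞) z) :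
    ContDiff ℝ (⊤ : ℕ∞) (fun p => (!₂[x p, y p, z p] : E3)) := by
  rw [contDiff_euclidean]
  intro i
  fin_cases i
  · simpa using hx
  · simpa using hy
  · simpa using hz

lemma int_eq_of_Ico {s t : ℝ} (hs : s ∈ Set.Ico (0 : ℝ) 1) (ht : t ∈ Set.Ico (0 : ℝ) 1)
    (h : ∃ m : ℤ, s = t + m) : s = t := by
  obtain ⟨m, hm⟩ := h
  have h1 : (m : ℝ) < 1 := by linarith [hs.2, ht.1]
  have h2 : (-1 : ℝ) < m := by linarith [hs.1, ht.2]
  have h3 : m < 1 := by exact_mod_cast h1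
  have h4 : -1 < m := by exact_mod_cast h2
  have : m = 0 := by omega
  simp [hm, this]

lemma Knot3.isKnot {x y z : ℝ → ℝ} (h : Knot3 x y z) : IsKnot (mkc x y z) where
  smooth := contDiff_mkc2 h.cx h.cy h.cz
  periodic := fun t => by simp [mkc, h.px t, h.py t, h.pz t]
  injOn := fun s hs t ht e => by
    obtain ⟨a, b, c⟩ := mkc_inj e
    exact int_eq_of_Ico hs ht (h.inj s t a b c)
  deriv_ne := fun t e => by
    rw [deriv_mkc h.cx h.cy h.cz] at e
    obtain ⟨a, b, c⟩ := vec_eq_zero e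
    exact h.imm t a b c

lemma fract_shift (t : ℝ) : ∃ m : ℤ, Int.fract t = t + m := ⟨-⌊t⌋, by
  rw [Int.fract]; push_cast; ring⟩

lemma IsKnot.knot3 {K : ℝ → E3} (h : IsKnot K) :
    ∃ x y z, K = mkc x y z ∧ Knot3 x y z := by
  have hc : ∀ i, ContDiff ℝ (⊤ : ℕ∞) (fun t => K t i) := contDiff_euclidean.1 h.smooth
  have hp : ∀ i, Function.Periodic (fun t => K t i) 1 := fun i t => by simp [h.periodic t]
  have e : K = mkc (fun t => K t 0) (fun t => K t 1) (fun t => K t 2) := by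
    funext t
    ext i
    fin_cases i <;> simp [mkc]
  refine ⟨_, _, _, e, hc 0, hc 1, hc 2, hp 0, hp 1, hp 2, ?_, ?_⟩
  · intro s t h0 h1 h2
    obtain ⟨m, hm⟩ := fract_shift s
    obtain ⟨n, hn⟩ := fract_shift t
    have key : K (Int.fract s) = K (Int.fract t) := by
      ext i
      have a := per_int (hp i) s m
      have b := per_int (hp i) t n
      simp only at a b
      rw [hm, hn, a, b]
      fin_cases i
      · exact h0
      · exact h1
      · exact h2
    have := h.injOn ⟨Int.fract_nonneg s, Int.fract_lt_one s⟩
      ⟨Int.fract_nonneg t, Int.fract_lt_one t⟩ key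
    refine ⟨n - m, ?_⟩
    push_cast
    linarith
  · intro t a b c
    apply h.deriv_ne t
    rw [e, deriv_mkc (hc 0) (hc 1) (hc 2), a, b, c]
    ext i
    fin_cases i <;> simp

lemma iso_eq {V : (ℝ → E3) → ℝ} (hV : IsKnotInvariant V) (X Y Z : ℝ → ℝ → ℝ)
    (hX : ContDiff ℝ (⊤ : ℕ∞) (fun p : ℝ × ℝ => X p.1 p.2))
    (hY : ContDiff ℝ (⊤ : ℕ∞) (fun p : ℝ × ℝ => Y p.1 p.2))
    (hZ : ContDiff ℝ (⊤ : ℕ∞) (fun p : ℝ × ℝ => Z p.1 p.2))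
    (hK : ∀ l ∈ Set.Icc (0 : ℝ) 1, Knot3 (X l) (Y l) (Z l)) :
    V (mkc (X 0) (Y 0) (Z 0)) = V (mkc (X 1) (Y 1) (Z 1)) := by
  apply hV _ _ (hK 0 (by simp)).isKnot (hK 1 (by simp)).isKnot
  exact ⟨fun l => mkc (X l) (Y l) (Z l), contDiff_mkc2 hX hY hZ, fun l hl => (hK l hl).isKnot,
    rfl, rfl⟩

/-- A plane curve that is immersed with only transverse self-intersections. -/
structure Gen (x y : ℝ → ℝ) : Prop where
  cx : ContDiff ℝ (⊤ : ℕ∞) x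
  cy : ContDiff ℝ (⊤ : ℕ∞) y
  px : Function.Periodic x 1
  py : Function.Periodic y 1
  imm : ∀ t, deriv x t = 0 → deriv y t ≠ 0
  trans : ∀ s t, x s = x t → y s = y t → (∃ m : ℤ, s = t + m) ∨
    deriv x s * deriv y t - deriv y s * deriv x t ≠ 0

lemma hasFDerivAt_quot {x z : ℝ → ℝ} {x1 x2 z1 z2 : ℝ} {p : ℝ × ℝ}
    (hx1 : HasDerivAt x x1 p.1) (hx2 : HasDerivAt x x2 p.2)
    (hz1 : HasDerivAt z z1 p.1) (hz2 : HasDerivAt z z2 p.2) (h : z p.1 - z p.2 ≠ 0) :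
    ∃ L : ℝ × ℝ →L[ℝ] ℝ, HasFDerivAt (fun q : ℝ × ℝ => (x q.1 - x q.2) / (z q.1 - z q.2)) L p ∧
      ∀ v, L v = ((x1 - (x p.1 - x p.2) / (z p.1 - z p.2) * z1) * v.1 -
        (x2 - (x p.1 - x p.2) / (z p.1 - z p.2) * z2) * v.2) / (z p.1 - z p.2) := by
  have hN := (hx1.comp_hasFDerivAt p (hasFDerivAt_fst (𝕜 := ℝ) (E := ℝ) (F := ℝ))).sub
    (hx2.comp_hasFDerivAt p (hasFDerivAt_snd (𝕜 := ℝ) (E := ℝ) (F := ℝ)))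
  have hD := (hz1.comp_hasFDerivAt p (hasFDerivAt_fst (𝕜 := ℝ) (E := ℝ) (F := ℝ))).sub
    (hz2.comp_hasFDerivAt p (hasFDerivAt_snd (𝕜 := ℝ) (E := ℝ) (F := ℝ)))
  have hI := (hasDerivAt_inv h).comp_hasFDerivAt p hD
  have hM := hN.mul hI
  refine ⟨_, hM.congr_of_eventuallyEq (Filter.Eventually.of_forall fun q => ?_), ?_⟩
  · simp [div_eq_mul_inv]
  · intro v
    simp
    field_simp
    ring

lemma det_zero_of_ker {L : ℝ × ℝ →L[ℝ] ℝ × ℝ} (v : ℝ × ℝ) (hv : v ≠ 0) (h : L v = 0) :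
    L.det = 0 := by
  rw [ContinuousLinearMap.det, LinearMap.det_eq_zero_iff_ker_ne_bot]
  intro hb
  apply hv
  have : v ∈ (L : ℝ × ℝ →ₗ[ℝ] ℝ × ℝ).ker := by simpa using h
  rw [hb] at this
  simpa using this

lemma exists_dep {p1 p2 q1 q2 : ℝ} (h : p1 * q2 - p2 * q1 = 0) :
    ∃ v : ℝ × ℝ, v ≠ 0 ∧ p1 * v.1 - q1 * v.2 = 0 ∧ p2 * v.1 - q2 * v.2 = 0 := by
  by_cases h1 : q1 = 0 ∧ p1 = 0
  · by_cases h2 : q2 = 0 ∧ p2 = 0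
    · exact ⟨(1, 0), by simp, by simp [h1], by simp [h2]⟩
    · refine ⟨(q2, p2), by simpa [Prod.ext_iff] using h2, by simp [h1], by simp; ring⟩
  · refine ⟨(q1, p1), by simpa [Prod.ext_iff] using h1, by simp; ring, by simp; linarith⟩

lemma exists_generic {x y z : ℝ → ℝ} (h : Knot3 x y z) :
    ∃ a b : ℝ, Gen (fun t => x t - a * z t) (fun t => y t - b * z t) := by
  set G : ℝ × ℝ → ℝ × ℝ := fun q =>
    ((x q.1 - x q.2) / (z q.1 - z q.2), (y q.1 - y q.2) / (z q.1 - z q.2)) with hG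
  set S : Set (ℝ × ℝ) := {q | z q.1 - z q.2 ≠ 0 ∧
    (deriv x q.1 - (G q).1 * deriv z q.1) * (deriv y q.2 - (G q).2 * deriv z q.2) -
    (deriv y q.1 - (G q).2 * deriv z q.1) * (deriv x q.2 - (G q).1 * deriv z q.2) = 0} with hS
  set G2 : ℝ × ℝ → ℝ × ℝ := fun q => (deriv x q.1 / deriv z q.1, deriv y q.1 / deriv z q.1) with hG2
  set S2 : Set (ℝ × ℝ) := {q | deriv z q.1 ≠ 0} with hS2
  have dx := smooth_diff h.cx
  have dy := smooth_diff h.cy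
  have dz := smooth_diff h.cz
  have A : ∀ p ∈ S, ∃ L : ℝ × ℝ →L[ℝ] ℝ × ℝ, HasFDerivAt G L p ∧ L.det = 0 := by
    intro p hp
    obtain ⟨L1, h1, k1⟩ := hasFDerivAt_quot (dx p.1) (dx p.2) (dz p.1) (dz p.2) hp.1
    obtain ⟨L2, h2, k2⟩ := hasFDerivAt_quot (dy p.1) (dy p.2) (dz p.1) (dz p.2) hp.1
    obtain ⟨v, hv, e1, e2⟩ := exists_dep hp.2
    refine ⟨L1.prod L2, h1.prodMk h2, det_zero_of_ker v hv ?_⟩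
    simp only [ContinuousLinearMap.prod_apply, k1, k2]
    simp only [hG] at e1 e2
    rw [e1, e2]
    simp
  have ddx : Differentiable ℝ (deriv x) :=
    ((contDiff_infty_iff_deriv (f := x)).1 h.cx).2.differentiable (by simp)
  have ddy : Differentiable ℝ (deriv y) :=
    ((contDiff_infty_iff_deriv (f := y)).1 h.cy).2.differentiable (by simp)
  have ddz : Differentiable ℝ (deriv z) :=
    ((contDiff_infty_iff_deriv (f := z)).1 h.cz).2.differentiable (by simp)
  have A2 : ∀ p ∈ S2, ∃ L : ℝ × ℝ →L[ℝ] ℝ × ℝ, HasFDerivAt G2 L p ∧ L.det = 0 := by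
    intro p hp
    have hg : DifferentiableAt ℝ (fun t => (deriv x t / deriv z t, deriv y t / deriv z t)) p.1 :=
      ((ddx _).div (ddz _) hp).prodMk ((ddy _).div (ddz _) hp)
    refine ⟨_, hg.hasFDerivAt.comp p hasFDerivAt_fst, det_zero_of_ker (0, 1) (by simp) ?_⟩
    simp
  choose! L hL hL' using A
  choose! L2 hL2 hL2' using A2
  have n1 : MeasureTheory.volume (G '' S) = 0 :=
    MeasureTheory.addHaar_image_eq_zero_of_det_fderivWithin_eq_zero _
      (fun p hp => (hL p hp).hasFDerivWithinAt) hL'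
  have n2 : MeasureTheory.volume (G2 '' S2) = 0 :=
    MeasureTheory.addHaar_image_eq_zero_of_det_fderivWithin_eq_zero _
      (fun p hp => (hL2 p hp).hasFDerivWithinAt) hL2'
  have n3 : MeasureTheory.volume (G '' S ∪ G2 '' S2) = 0 := MeasureTheory.measure_union_null n1 n2
  obtain ⟨⟨a, b⟩, hab⟩ : ∃ c, c ∉ G '' S ∪ G2 '' S2 := by
    by_contra hc
    push Not at hc
    rw [Set.eq_univ_of_forall hc] at n3
    simp at n3
  have Dx : ∀ t, deriv (fun t => x t - a * z t) t = deriv x t - a * deriv z t := fun t =>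
    ((dx t).sub ((dz t).const_mul a)).deriv
  have Dy : ∀ t, deriv (fun t => y t - b * z t) t = deriv y t - b * deriv z t := fun t =>
    ((dy t).sub ((dz t).const_mul b)).deriv
  refine ⟨a, b, h.cx.sub (contDiff_const.mul h.cz), h.cy.sub (contDiff_const.mul h.cz),
    fun t => by simp [h.px t, h.pz t], fun t => by simp [h.py t, h.pz t], ?_, ?_⟩
  · intro t e1 e2
    rw [Dx] at e1
    rw [Dy] at e2
    have hz : deriv z t ≠ 0 := by
      intro hz
      rw [hz] at e1 e2
      exact h.imm t (by linarith) (by linarith) hz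
    apply hab
    right
    refine ⟨(t, 0), hz, ?_⟩
    simp only [hG2, Prod.mk.injEq]
    constructor
    · field_simp
      linarith
    · field_simp
      linarith
  · intro s t e1 e2
    by_contra hc
    push Not at hc
    obtain ⟨hm, hd⟩ := hc
    rw [Dx, Dy, Dx, Dy] at hd
    have hz : z s - z t ≠ 0 := by
      intro hz
      have hz' : z s = z t := by linarith
      rw [hz'] at e1 e2
      obtain ⟨m, hm'⟩ := h.inj s t (by linarith) (by linarith) hz'
      exact hm m hm'
    have hGe : G (s, t) = (a, b) := by
      simp only [hG, Prod.mk.injEq]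
      constructor
      · field_simp
        linarith
      · field_simp
        linarith
    apply hab
    left
    refine ⟨(s, t), ⟨hz, ?_⟩, hGe⟩
    rw [hGe]
    exact hd

lemma local_inj {x : ℝ → ℝ} (hx : ContDiff ℝ (⊤ : ℕ∞) x) {s : ℝ} (h : deriv x s ≠ 0) :
    ∀ᶠ p : ℝ × ℝ in 𝓝 (s, s), x p.1 = x p.2 → p.1 = p.2 := by
  have hs : HasStrictDerivAt x (deriv x s) s :=
    (hx.contDiffAt).hasStrictDerivAt (by simp)
  have e := hs.eventually_left_inverse h
  have e1 : ∀ᶠ p : ℝ × ℝ in 𝓝 (s, s), HasStrictDerivAt.localInverse x (deriv x s) s hs h (x p.1) = p.1 :=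
    (continuous_fst.tendsto (s, s)).eventually e
  have e2 : ∀ᶠ p : ℝ × ℝ in 𝓝 (s, s), HasStrictDerivAt.localInverse x (deriv x s) s hs h (x p.2) = p.2 :=
    (continuous_snd.tendsto (s, s)).eventually e
  filter_upwards [e1, e2] with p h1 h2 h3
  rw [← h1, h3, h2]

lemma finite_double {x y : ℝ → ℝ} (g : Gen x y) :
    {p : ℝ × ℝ | p ∈ Set.Icc (0 : ℝ) 1 ×ˢ Set.Icc (0 : ℝ) 1 ∧ x p.1 = x p.2 ∧ y p.1 = y p.2 ∧
      ¬ ∃ m : ℤ, p.1 = p.2 + m}.Finite := by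
  by_contra hinf
  obtain ⟨⟨s, t⟩, -, hacc⟩ := Set.Infinite.exists_accPt_of_subset_isCompact hinf
    (isCompact_Icc.prod isCompact_Icc) (fun p hp => hp.1)
  rw [accPt_iff_frequently_nhdsNE] at hacc
  have hfr := hacc.filter_mono (nhdsWithin_le_nhds (a := (s, t)) (s := {(s, t)}ᶜ))
  have hcl : ∀ f : ℝ → ℝ, Continuous f → (∃ᶠ p : ℝ × ℝ in 𝓝 (s, t), f p.1 = f p.2) → f s = f t := by
    intro f hf h
    have hc : IsClosed {p : ℝ × ℝ | f p.1 = f p.2} :=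
      isClosed_eq (hf.comp continuous_fst) (hf.comp continuous_snd)
    exact hc.mem_of_frequently_of_tendsto h Filter.tendsto_id
  have ex := hcl x g.cx.continuous (hfr.mono fun p hp => hp.2.1)
  have ey := hcl y g.cy.continuous (hfr.mono fun p hp => hp.2.2.1)
  by_cases hm : ∃ m : ℤ, s = t + m
  · obtain ⟨m, hm⟩ := hm
    have key : ∀ᶠ p : ℝ × ℝ in 𝓝 (s, s), x p.1 = x p.2 → y p.1 = y p.2 → p.1 = p.2 := by
      by_cases hx : deriv x s = 0
      · filter_upwards [local_inj g.cy (g.imm s hx)] with p hp _ h2 using hp h2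
      · filter_upwards [local_inj g.cx hx] with p hp h1 _ using hp h1
    have ht : Filter.Tendsto (fun p : ℝ × ℝ => (p.1, p.2 + (m : ℝ))) (𝓝 (s, t)) (𝓝 (s, s)) := by
      have : Continuous (fun p : ℝ × ℝ => (p.1, p.2 + (m : ℝ))) := by fun_prop
      have := this.tendsto (s, t)
      simpa [← hm] using this
    have key2 := ht.eventually key
    obtain ⟨p, ⟨-, h1, h2, h3⟩, h4⟩ := (hfr.and_eventually key2).exists
    simp only [per_int g.px, per_int g.py] at h4
    exact h3 ⟨m, h4 h1 h2⟩
  · have hd := (g.trans s t ex ey).resolve_left hm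
    have A : ∀ f : ℝ → ℝ, ContDiff ℝ (⊤ : ℕ∞) f → HasFDerivAt (fun p : ℝ × ℝ => f p.1 - f p.2)
        (deriv f s • ContinuousLinearMap.fst ℝ ℝ ℝ - deriv f t • ContinuousLinearMap.snd ℝ ℝ ℝ)
        (s, t) := by
      intro f hf
      exact ((smooth_diff hf s).comp_hasFDerivAt (s, t)
        (hasFDerivAt_fst (𝕜 := ℝ) (E := ℝ) (F := ℝ) (p := (s, t)))).sub
        ((smooth_diff hf t).comp_hasFDerivAt (s, t)
        (hasFDerivAt_snd (𝕜 := ℝ) (E := ℝ) (F := ℝ) (p := (s, t))))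
    have B := (A x g.cx).prodMk (A y g.cy)
    have C := B.eventually_ne (c := 0) (by
      obtain ⟨K, -, hK⟩ := LinearMap.exists_antilipschitzWith
        (((deriv x s • ContinuousLinearMap.fst ℝ ℝ ℝ - deriv x t • ContinuousLinearMap.snd ℝ ℝ ℝ).prod
        (deriv y s • ContinuousLinearMap.fst ℝ ℝ ℝ - deriv y t • ContinuousLinearMap.snd ℝ ℝ ℝ) :
          ℝ × ℝ →L[ℝ] ℝ × ℝ) : ℝ × ℝ →ₗ[ℝ] ℝ × ℝ) (by
          rw [LinearMap.ker_eq_bot']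
          rintro ⟨u, v⟩ h
          simp at h
          obtain ⟨h1, h2⟩ := h
          have hu : u = 0 := by
            have : (deriv x s * deriv y t - deriv y s * deriv x t) * u = 0 := by
              linear_combination deriv y t * h1 - deriv x t * h2
            exact (mul_eq_zero.1 this).resolve_left hd
          have hv : v = 0 := by
            have : (deriv x s * deriv y t - deriv y s * deriv x t) * v = 0 := by
              linear_combination deriv y s * h1 - deriv x s * h2
            exact (mul_eq_zero.1 this).resolve_left hd
          simp [hu, hv])
      exact ⟨K, hK⟩)
    obtain ⟨p, hp, h4⟩ := (hacc.and_eventually C).exists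
    apply h4
    simp [hp.2.1, hp.2.2.1]

lemma exists_chi (P : Finset ℝ) (hP : ∀ p ∈ P, p ∈ Set.Ico (0 : ℝ) 1) (p : ℝ) (hp : p ∈ P) :
    ∃ c : ℝ → ℝ, ContDiff ℝ (⊤ : ℕ∞) c ∧ Function.Periodic c 1 ∧ c p = 1 ∧
      (∀ q ∈ P, q ≠ p → c q = 0) ∧ ∀ q ∈ P, deriv c q = 0 := by
  set u : ℝ → ℝ := fun t => ∏ q ∈ P.erase p,
    (Real.sin (Real.pi * (t - q)) ^ 2 / Real.sin (Real.pi * (p - q)) ^ 2) with hu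
  have cu : ContDiff ℝ (⊤ : ℕ∞) u := by
    apply contDiff_prod
    intro q _
    apply ContDiff.div_const
    exact (Real.contDiff_sin.comp (by fun_prop)).pow 2
  have pu : Function.Periodic u 1 := by
    intro t
    simp only [hu]
    apply Finset.prod_congr rfl
    intro q _
    have : Real.pi * (t + 1 - q) = Real.pi * (t - q) + Real.pi := by ring
    rw [this, Real.sin_add_pi]
    ring
  have u1 : u p = 1 := by
    simp only [hu]
    apply Finset.prod_eq_one
    intro q hq
    rw [Finset.mem_erase] at hq
    apply div_self
    apply pow_ne_zero
    rw [Ne, Real.sin_eq_zero_iff]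
    rintro ⟨n, hn⟩
    have : p = q + n := by
      have := mul_left_cancel₀ Real.pi_ne_zero (a := Real.pi) (b := (n : ℝ)) (c := p - q) (by linarith)
      linarith
    exact hq.1 (int_eq_of_Ico (hP p hp) (hP q hq.2) ⟨n, this⟩).symm
  have u0 : ∀ q ∈ P, q ≠ p → u q = 0 := by
    intro q hq hqp
    apply Finset.prod_eq_zero (Finset.mem_erase.2 ⟨hqp, hq⟩)
    simp
  refine ⟨fun t => 3 * u t ^ 2 - 2 * u t ^ 3, by fun_prop, fun t => by simp [pu t],
    by simp [u1]; norm_num, fun q hq hqp => by simp [u0 q hq hqp], ?_⟩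
  intro q hq
  have d := smooth_diff cu q
  have := (((d.pow 2).const_mul 3).sub ((d.pow 3).const_mul 2)).deriv
  have e : deriv (fun t => 3 * u t ^ 2 - 2 * u t ^ 3) q = _ := this
  rw [e]
  by_cases hqp : q = p
  · rw [hqp, u1]; norm_num; ring
  · rw [u0 q hq hqp]; norm_num

lemma const_of_local (f : ℝ → ℝ) (G : Set ℝ) (hG : Gᶜ.Finite)
    (h : ∀ b, ∃ ε > 0, ∃ v, ∀ u, |u - b| < ε → u ∈ G → f u = v) :
    ∀ u ∈ G, ∀ u' ∈ G, f u = f u' := by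
  have hd : Dense G := by
    have := hG.countable.dense_compl ℝ
    simpa using this
  choose ε hε v hv using h
  have hl : IsLocallyConstant v := by
    rw [IsLocallyConstant.iff_eventually_eq]
    intro b
    have : ∀ᶠ b' in 𝓝 b, |b' - b| < ε b := by
      have := Metric.ball_mem_nhds b (hε b)
      filter_upwards [this] with b' hb'
      simpa [Real.dist_eq] using hb'
    filter_upwards [this] with b' hb'
    have ho : IsOpen {u : ℝ | |u - b| < ε b ∧ |u - b'| < ε b'} := by
      have c : ∀ r : ℝ, Continuous (fun u : ℝ => |u - r|) := fun r => by fun_prop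
      exact (isOpen_lt (c b) continuous_const).inter (isOpen_lt (c b') continuous_const)
    obtain ⟨u, hu1, hu2⟩ := hd.inter_open_nonempty _ ho ⟨b', hb', by simpa using hε b'⟩
    rw [← hv b u hu1.1 hu2, ← hv b' u hu1.2 hu2]
  intro u hu u' hu'
  rw [hv u u (by simpa using hε u) hu, hv u' u' (by simpa using hε u') hu']
  exact hl.apply_eq_of_preconnectedSpace _ _

/-- Invariance under all crossing changes. -/
def Type0 (V : (ℝ → E3) → ℝ) : Prop :=
  ∀ (F : ℝ → E3) (s t : ℝ) (φ : ℝ → ℝ) (ε : ℝ),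
      ContDiff ℝ (⊤ : ℕ∞) F → Function.Periodic F 1 → (∀ x, deriv F x ≠ 0) →
      s ∈ Set.Ico (0 : ℝ) 1 → t ∈ Set.Ico (0 : ℝ) 1 → s ≠ t → F s = F t →
      (∀ x ∈ Set.Ico (0 : ℝ) 1, ∀ y ∈ Set.Ico (0 : ℝ) 1, F x = F y →
        x = y ∨ (x = s ∧ y = t) ∨ (x = t ∧ y = s)) →
      LinearIndependent ℝ ![deriv F s, deriv F t] →
      ContDiff ℝ (⊤ : ℕ∞) φ → Function.Periodic φ 1 → φ t = 1 →
      (∀ x : ℝ, φ x ≠ 0 → ¬ ∃ m : ℤ, x = s + m) →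
      0 < ε →
      IsKnot (fun x => F x + ε • (φ x • cross3 (deriv F s) (deriv F t))) →
      IsKnot (fun x => F x - ε • (φ x • cross3 (deriv F s) (deriv F t))) →
      V (fun x => F x + ε • (φ x • cross3 (deriv F s) (deriv F t))) =
        V (fun x => F x - ε • (φ x • cross3 (deriv F s) (deriv F t)))

/-- `h` separates the double points of the plane curve `(x, y)` with parameters in `P`. -/
def Good (P : Finset ℝ) (x y h : ℝ → ℝ) : Prop :=
  ∀ p ∈ P, ∀ q ∈ P, p ≠ q → x p = x q → y p = y q → h p ≠ h q

/-- `P` is a finite set of parameters in `[0,1)` containing all double parameters. -/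
structure Dbl (P : Finset ℝ) (x y : ℝ → ℝ) : Prop where
  ico : ∀ p ∈ P, p ∈ Set.Ico (0 : ℝ) 1
  mem : ∀ s ∈ Set.Ico (0 : ℝ) 1, ∀ t ∈ Set.Ico (0 : ℝ) 1, s ≠ t → x s = x t → y s = y t → s ∈ P

lemma exists_dbl {x y : ℝ → ℝ} (g : Gen x y) : ∃ P, Dbl P x y := by
  have h := (finite_double g).image Prod.fst
  refine ⟨h.toFinset.filter (fun s => s ∈ Set.Ico (0 : ℝ) 1), ?_, ?_⟩
  · intro p hp
    exact (Finset.mem_filter.1 hp).2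
  · intro s hs t ht hst hx hy
    rw [Finset.mem_filter]
    refine ⟨?_, hs⟩
    rw [Set.Finite.mem_toFinset]
    exact ⟨(s, t), ⟨⟨⟨hs.1, hs.2.le⟩, ⟨ht.1, ht.2.le⟩⟩, hx, hy,
      fun hm => hst (int_eq_of_Ico hs ht hm)⟩, rfl⟩

lemma knot_of_good {P : Finset ℝ} {x y z : ℝ → ℝ} (g : Gen x y) (d : Dbl P x y)
    (cz : ContDiff ℝ (⊤ : ℕ∞) z) (pz : Function.Periodic z 1) (h : Good P x y z) :
    Knot3 x y z := by
  refine ⟨g.cx, g.cy, cz, g.px, g.py, pz, ?_, fun t a b => absurd b (g.imm t a)⟩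
  intro s t hx hy hz
  obtain ⟨m, hm⟩ := fract_shift s
  obtain ⟨n, hn⟩ := fract_shift t
  have hs' : Int.fract s ∈ Set.Ico (0 : ℝ) 1 := ⟨Int.fract_nonneg s, Int.fract_lt_one s⟩
  have ht' : Int.fract t ∈ Set.Ico (0 : ℝ) 1 := ⟨Int.fract_nonneg t, Int.fract_lt_one t⟩
  have ex : x (Int.fract s) = x (Int.fract t) := by rw [hm, hn, per_int g.px, per_int g.px, hx]
  have ey : y (Int.fract s) = y (Int.fract t) := by rw [hm, hn, per_int g.py, per_int g.py, hy]
  have ez : z (Int.fract s) = z (Int.fract t) := by rw [hm, hn, per_int pz, per_int pz, hz]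
  have : Int.fract s = Int.fract t := by
    by_contra hne
    exact h _ (d.mem _ hs' _ ht' hne ex ey) _ (d.mem _ ht' _ hs' (Ne.symm hne) ex.symm ey.symm)
      hne ex ey ez
  refine ⟨n - m, ?_⟩
  push_cast
  linarith

lemma good_of_knot {P : Finset ℝ} {x y z : ℝ → ℝ} (d : Dbl P x y) (k : Knot3 x y z) :
    Good P x y z := fun p hp q hq hne hx hy hz =>
  hne (int_eq_of_Ico (d.ico p hp) (d.ico q hq) (k.inj p q hx hy hz))

lemma same_order {V : (ℝ → E3) → ℝ} (hV : IsKnotInvariant V) {P : Finset ℝ} {x y z w : ℝ → ℝ}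
    (g : Gen x y) (d : Dbl P x y)
    (cz : ContDiff ℝ (⊤ : ℕ∞) z) (pz : Function.Periodic z 1) (hz : Good P x y z)
    (cw : ContDiff ℝ (⊤ : ℕ∞) w) (pw : Function.Periodic w 1)
    (h : ∀ p ∈ P, ∀ q ∈ P, p ≠ q → x p = x q → y p = y q → z p < z q → w p < w q) :
    V (mkc x y z) = V (mkc x y w) := by
  have cx := g.cx
  have cy := g.cy
  have := iso_eq hV (fun _ => x) (fun _ => y) (fun l t => (1 - l) * z t + l * w t)
    (by fun_prop) (by fun_prop) (by fun_prop) (by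
      intro l hl
      refine knot_of_good g d (by fun_prop) (fun t => by simp [pz t, pw t]) ?_
      have key : ∀ p ∈ P, ∀ q ∈ P, p ≠ q → x p = x q → y p = y q → z p < z q →
          (1 - l) * z p + l * w p < (1 - l) * z q + l * w q := by
        intro p hp q hq hne hx hy hlt
        have h2 := h p hp q hq hne hx hy hlt
        have l0 := hl.1
        have l1 := hl.2
        by_cases hl' : l = 0
        · simpa [hl'] using hlt
        · have : 0 < l := lt_of_le_of_ne l0 (Ne.symm hl')
          nlinarith
      intro p hp q hq hne hx hy
      rcases lt_or_gt_of_ne (hz p hp q hq hne hx hy) with hlt | hlt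
      · exact (key p hp q hq hne hx hy hlt).ne
      · exact (key q hq p hp hne.symm hx.symm hy.symm hlt).ne')
  simpa using this

section
variable {V : (ℝ → E3) → ℝ} {P : Finset ℝ} {x y : ℝ → ℝ} {χ : ℝ → ℝ → ℝ}

/-- A family of bump functions separating the points of `P`. -/
structure Bump (P : Finset ℝ) (χ : ℝ → ℝ → ℝ) : Prop where
  c : ∀ p ∈ P, ContDiff ℝ (⊤ : ℕ∞) (χ p)
  per : ∀ p ∈ P, Function.Periodic (χ p) 1
  one : ∀ p ∈ P, χ p p = 1
  zero : ∀ p ∈ P, ∀ q ∈ P, q ≠ p → χ p q = 0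
  der : ∀ p ∈ P, ∀ q ∈ P, deriv (χ p) q = 0

/-- The height function with prescribed values on `P`. -/
noncomputable def zz (P : Finset ℝ) (χ : ℝ → ℝ → ℝ) (h : ℝ → ℝ) : ℝ → ℝ :=
  fun t => ∑ p ∈ P, h p * χ p t

lemma zz_c (b : Bump P χ) (h : ℝ → ℝ) : ContDiff ℝ (⊤ : ℕ∞) (zz P χ h) :=
  ContDiff.sum fun p hp => contDiff_const.mul (b.c p hp)

lemma zz_per (b : Bump P χ) (h : ℝ → ℝ) : Function.Periodic (zz P χ h) 1 := fun t =>
  Finset.sum_congr rfl fun p hp => by rw [b.per p hp t]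

lemma zz_val (b : Bump P χ) (h : ℝ → ℝ) (q : ℝ) (hq : q ∈ P) : zz P χ h q = h q := by
  rw [zz, Finset.sum_eq_single q]
  · rw [b.one q hq, mul_one]
  · intro p hp hpq
    rw [b.zero p hp q hq hpq.symm, mul_zero]
  · intro h; exact absurd hq h

lemma zz_der (b : Bump P χ) (h : ℝ → ℝ) (q : ℝ) (hq : q ∈ P) : deriv (zz P χ h) q = 0 := by
  have : HasDerivAt (fun t => ∑ p ∈ P, h p * χ p t) (∑ p ∈ P, h p * deriv (χ p) q) q :=
    HasDerivAt.fun_sum fun p hp => (smooth_diff (b.c p hp) q).const_mul (h p)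
  have e : deriv (zz P χ h) q = _ := this.deriv
  rw [e]
  exact Finset.sum_eq_zero fun p hp => by rw [b.der p hp q hq, mul_zero]

lemma zz_update (h : ℝ → ℝ) (p : ℝ) (hp : p ∈ P) (u t : ℝ) :
    zz P χ (Function.update h p u) t = zz P χ h t + (u - h p) * χ p t := by
  have : zz P χ (Function.update h p u) t - zz P χ h t = (u - h p) * χ p t := by
    rw [zz, zz, ← Finset.sum_sub_distrib, Finset.sum_eq_single p]
    · simp; ring
    · intro q _ hq
      simp [hq]
    · intro h; exact absurd hp h
  linarith

lemma zz_good (b : Bump P χ) {h : ℝ → ℝ} (hh : Good P x y h) : Good P x y (zz P χ h) := by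
  intro p hp q hq
  rw [zz_val b h p hp, zz_val b h q hq]
  exact hh p hp q hq

lemma zz_same (hV : IsKnotInvariant V) (g : Gen x y) (d : Dbl P x y) (b : Bump P χ) {h k : ℝ → ℝ}
    (hh : Good P x y h)
    (hk : ∀ p ∈ P, ∀ q ∈ P, p ≠ q → x p = x q → y p = y q → h p < h q → k p < k q) :
    V (mkc x y (zz P χ h)) = V (mkc x y (zz P χ k)) := by
  apply same_order hV g d (zz_c b h) (zz_per b h) (zz_good b hh) (zz_c b k) (zz_per b k)
  intro p hp q hq
  rw [zz_val b h p hp, zz_val b h q hq, zz_val b k p hp, zz_val b k q hq]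
  exact hk p hp q hq

lemma cross_vec (a b c d : ℝ) :
    cross3 (!₂[a, b, 0] : E3) !₂[c, d, 0] = !₂[0, 0, a * d - b * c] := by
  ext i
  fin_cases i <;> simp [cross3]

lemma crossing (ht : Type0 V) (g : Gen x y) (d : Dbl P x y) (b : Bump P χ) (h : ℝ → ℝ)
    (p q : ℝ) (hp : p ∈ P) (hq : q ∈ P) (hne : q ≠ p) (hx : x q = x p) (hy : y q = y p)
    (hpq : h p = h q)
    (huniq : ∀ r ∈ P, ∀ r' ∈ P, r ≠ r' → x r = x r' → y r = y r' → h r = h r' →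
      (r = q ∧ r' = p) ∨ (r = p ∧ r' = q))
    (ε : ℝ) (hε : 0 < ε)
    (h1 : Good P x y (Function.update h p (h p + ε)))
    (h2 : Good P x y (Function.update h p (h p - ε))) :
    V (mkc x y (zz P χ (Function.update h p (h p + ε)))) =
      V (mkc x y (zz P χ (Function.update h p (h p - ε)))) := by
  set D := deriv x q * deriv y p - deriv y q * deriv x p with hD
  have hD0 : D ≠ 0 := by
    rcases g.trans q p hx hy with hm | hm
    · exact absurd (int_eq_of_Ico (d.ico q hq) (d.ico p hp) hm) hne
    · exact hm
  set F := mkc x y (zz P χ h) with hF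
  have dF : ∀ t, deriv F t = !₂[deriv x t, deriv y t, deriv (zz P χ h) t] :=
    deriv_mkc g.cx g.cy (zz_c b h)
  have hcr : cross3 (deriv F q) (deriv F p) = !₂[0, 0, D] := by
    rw [dF, dF, zz_der b h q hq, zz_der b h p hp, cross_vec]
  have eplus : ∀ e : ℝ, (fun t => F t + e • (χ p t • cross3 (deriv F q) (deriv F p))) =
      mkc x y (zz P χ (Function.update h p (h p + e * D))) := by
    intro e
    funext t
    rw [hcr]
    ext i
    fin_cases i
    · simp [hF, mkc]
    · simp [hF, mkc]
    · simp [hF, mkc, zz_update h p hp]; ring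
  have eminus : ∀ e : ℝ, (fun t => F t - e • (χ p t • cross3 (deriv F q) (deriv F p))) =
      mkc x y (zz P χ (Function.update h p (h p - e * D))) := by
    intro e
    have := eplus (-e)
    rw [show h p - e * D = h p + (-e) * D by ring, ← this]
    funext t
    rw [neg_smul, sub_eq_add_neg]
  have k1 := (knot_of_good g d (zz_c b _) (zz_per b _) (zz_good b h1)).isKnot
  have k2 := (knot_of_good g d (zz_c b _) (zz_per b _) (zz_good b h2)).isKnot
  have T := ht F q p (χ p) (ε / |D|) (contDiff_mkc2 g.cx g.cy (zz_c b h))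
    (fun t => by simp [hF, mkc, g.px t, g.py t, zz_per b h t])
    (fun t e => by
      rw [dF] at e
      obtain ⟨e1, e2, -⟩ := vec_eq_zero e
      exact g.imm t e1 e2)
    (d.ico q hq) (d.ico p hp) hne
    (by simp [hF, mkc, hx, hy, zz_val b h q hq, zz_val b h p hp, hpq])
    (by
      intro r hr r' hr' e
      obtain ⟨e1, e2, e3⟩ := mkc_inj e
      by_cases hrr : r = r'
      · exact Or.inl hrr
      · right
        have m1 := d.mem r hr r' hr' hrr e1 e2
        have m2 := d.mem r' hr' r hr (Ne.symm hrr) e1.symm e2.symm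
        rw [zz_val b h r m1, zz_val b h r' m2] at e3
        exact huniq r m1 r' m2 hrr e1 e2 e3)
    (by
      rw [LinearIndependent.pair_iff]
      intro s t e
      rw [dF, dF] at e
      have e0 := congrArg (fun v : E3 => v 0) e
      have e1 := congrArg (fun v : E3 => v 1) e
      simp at e0 e1
      constructor
      · have : D * s = 0 := by
          rw [hD]; linear_combination deriv y p * e0 - deriv x p * e1
        exact (mul_eq_zero.1 this).resolve_left hD0
      · have : D * t = 0 := by
          rw [hD]; linear_combination deriv x q * e1 - deriv y q * e0
        exact (mul_eq_zero.1 this).resolve_left hD0)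
    (b.c p hp) (b.per p hp) (b.one p hp)
    (by
      rintro t h0 ⟨m, rfl⟩
      rw [per_int (b.per p hp), b.zero p hp q hq hne] at h0
      exact h0 rfl)
    (div_pos hε (abs_pos.2 hD0))
  rw [eplus, eminus] at T
  rcases lt_or_gt_of_ne hD0 with hneg | hpos
  · have : ε / |D| * D = -ε := by
      rw [abs_of_neg hneg]; field_simp
    rw [this, sub_neg_eq_add, ← sub_eq_add_neg] at T
    exact (T k2 k1).symm
  · have : ε / |D| * D = ε := by
      rw [abs_of_pos hpos]; field_simp
    rw [this] at T
    exact T k1 k2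

end

section
variable {V : (ℝ → E3) → ℝ} {P : Finset ℝ} {x y : ℝ → ℝ} {χ : ℝ → ℝ → ℝ}

lemma good_update {h : ℝ → ℝ} (hh : Good P x y h) (p : ℝ) (hp : p ∈ P) (u : ℝ) :
    Good P x y (Function.update h p u) ↔
      ∀ q ∈ P, q ≠ p → x q = x p → y q = y p → u ≠ h q := by
  constructor
  · intro hg q hq hne hx hy e
    apply hg q hq p hp hne hx hy
    simp [hne, e]
  · intro hg r hr r' hr' hne hx hy
    by_cases h1 : r = p
    · subst h1
      have := hg r' hr' (Ne.symm hne) hx.symm hy.symm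
      simpa [Ne.symm hne] using this
    · by_cases h2 : r' = p
      · subst h2
        have := hg r hr hne hx hy
        simpa [hne] using this.symm
      · simpa [h1, h2] using hh r hr r' hr' hne hx hy

lemma exists_gap (P : Finset ℝ) (h : ℝ → ℝ) (b : ℝ) :
    ∃ ε > 0, ∀ q ∈ P, h q ≠ b → ε ≤ |h q - b| := by
  have : ∀ᶠ ε : ℝ in 𝓝[>] 0, ∀ q ∈ P, h q ≠ b → ε ≤ |h q - b| := by
    rw [Filter.eventually_all_finset]
    intro q _
    by_cases hq : h q = b
    · exact Filter.Eventually.of_forall fun ε h => absurd hq h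
    · have : 0 < |h q - b| := abs_pos.2 (sub_ne_zero.2 hq)
      filter_upwards [Ioo_mem_nhdsGT this] with ε hε _ using hε.2.le
  obtain ⟨ε, h1, h2⟩ := (this.and self_mem_nhdsWithin).exists
  exact ⟨ε, h2, h1⟩

lemma step_one (hV : IsKnotInvariant V) (ht : Type0 V) (g : Gen x y) (d : Dbl P x y)
    (b : Bump P χ) {h : ℝ → ℝ} (hh : Good P x y h) (p : ℝ) (hp : p ∈ P) (c : ℝ)
    (hc : Good P x y (Function.update h p c)) :
    V (mkc x y (zz P χ h)) = V (mkc x y (zz P χ (Function.update h p c))) := by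
  set f : ℝ → ℝ := fun u => V (mkc x y (zz P χ (Function.update h p u))) with hf
  set G : Set ℝ := {u | Good P x y (Function.update h p u)} with hG
  have hfin : Gᶜ.Finite := by
    apply (P.image h).finite_toSet.subset
    intro u hu
    rw [Set.mem_compl_iff, hG, Set.mem_ofPred_eq, good_update hh p hp] at hu
    push Not at hu
    obtain ⟨q, hq, _, _, _, e⟩ := hu
    simp only [Finset.coe_image, Set.mem_image, Finset.mem_coe]
    exact ⟨q, hq, e.symm⟩
  have key : ∀ u ∈ G, ∀ u' ∈ G, f u = f u' := by
    apply const_of_local f G hfin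
    intro β
    obtain ⟨ε, hε, hgap⟩ := exists_gap P h β
    have side : ∀ u u', |u - β| < ε → |u' - β| < ε → u ∈ G → u' ∈ G →
        (∀ q ∈ P, q ≠ p → x q = x p → y q = y p → h q = β → (u < β ↔ u' < β)) → f u = f u' := by
      intro u u' hu hu' gu gu' hs
      have gu2 := (good_update hh p hp u).1 gu
      have gu2' := (good_update hh p hp u').1 gu'
      rw [abs_lt] at hu hu'
      apply zz_same hV g d b gu
      intro r hr r' hr' hne hx hy hlt
      by_cases h1 : r = p
      · subst h1
        simp only [Function.update_self, Function.update_of_ne (Ne.symm hne)] at hlt ⊢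
        by_cases e : h r' = β
        · have := hs r' hr' (Ne.symm hne) hx.symm hy.symm e
          rw [e] at hlt ⊢
          exact this.1 hlt
        · have := hgap r' hr' e
          rcases le_abs.1 this with a | a <;> linarith
      · by_cases h2 : r' = p
        · subst h2
          simp only [Function.update_self, Function.update_of_ne hne] at hlt ⊢
          by_cases e : h r = β
          · have a := hs r hr hne hx hy e
            have a2 := gu2' r hr hne hx hy
            rw [e] at hlt a2 ⊢
            rcases lt_or_gt_of_ne a2 with a3 | a3
            · linarith [a.2 a3]
            · exact a3
          · have := hgap r hr e
            rcases le_abs.1 this with a | a <;> linarith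
        · simpa [h1, h2] using hlt
    have hgd : ∀ u, |u - β| < ε → u ≠ β → u ∈ G := by
      intro u hu hne
      rw [hG, Set.mem_ofPred_eq, good_update hh p hp]
      intro q hq _ _ _ e
      by_cases e' : h q = β
      · exact hne (e.trans e')
      · have := hgap q hq e'
        rw [← e] at this
        linarith
    have a1 : |β + ε / 2 - β| < ε := by
      rw [add_sub_cancel_left, abs_of_pos (by linarith)]; linarith
    have a2 : |β - ε / 2 - β| < ε := by
      rw [sub_sub_cancel_left, abs_neg, abs_of_pos (by linarith)]; linarith
    have g1 := hgd _ a1 (by linarith)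
    have g2 := hgd _ a2 (by linarith)
    by_cases hq : ∃ q ∈ P, q ≠ p ∧ x q = x p ∧ y q = y p ∧ h q = β
    · have hcr : f (β + ε / 2) = f (β - ε / 2) := by
        obtain ⟨q, hq, hne, hx, hy, e⟩ := hq
        have := crossing ht g d b (Function.update h p β) p q hp hq hne hx hy
          (by simp [hne, e]) (by
            intro r hr r' hr' hrr hxr hyr her
            by_cases h1 : r = p
            · subst h1
              right
              refine ⟨rfl, ?_⟩
              by_contra hr'q
              simp only [Function.update_self, Function.update_of_ne (Ne.symm hrr)] at her
              exact hh r' hr' q hq hr'q (hxr.symm.trans hx.symm) (hyr.symm.trans hy.symm)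
                (her.symm.trans e.symm)
            · by_cases h2 : r' = p
              · subst h2
                left
                refine ⟨?_, rfl⟩
                by_contra hrq
                simp only [Function.update_self, Function.update_of_ne hrr] at her
                exact hh r hr q hq hrq (hxr.trans hx.symm) (hyr.trans hy.symm)
                  (her.trans e.symm)
              · simp only [Function.update_of_ne h1, Function.update_of_ne h2] at her
                exact absurd her (hh r hr r' hr' hrr hxr hyr)) (ε / 2) (by linarith)
        simp only [Function.update_self, Function.update_idem] at this
        exact this g1 g2
      refine ⟨ε, hε, f (β + ε / 2), ?_⟩
      intro u hu gu
      rcases lt_trichotomy u β with hlt | heq | hgt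
      · rw [hcr]
        apply side _ _ hu a2 gu g2
        intro q _ _ _ _ _
        exact ⟨fun _ => by linarith, fun _ => hlt⟩
      · exfalso
        obtain ⟨q, hq, hne, hx, hy, e⟩ := hq
        exact (good_update hh p hp u).1 gu q hq hne hx hy (heq.trans e.symm)
      · apply side _ _ hu a1 gu g1
        intro q _ _ _ _ _
        exact ⟨fun _ => by linarith, fun _ => by linarith⟩
    · refine ⟨ε, hε, f (β + ε / 2), ?_⟩
      intro u hu gu
      apply side _ _ hu a1 gu g1
      intro q h1 h2 h3 h4 h5
      exact absurd ⟨q, h1, h2, h3, h4, h5⟩ hq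
  have := key (h p) (by simpa [hG] using hh) c hc
  simpa [hf] using this

end

lemma change_z {V : (ℝ → E3) → ℝ} (hV : IsKnotInvariant V) (ht : Type0 V) {x y z w : ℝ → ℝ}
    (g : Gen x y) (kz : Knot3 x y z) (kw : Knot3 x y w) :
    V (mkc x y z) = V (mkc x y w) := by
  obtain ⟨P, d⟩ := exists_dbl g
  have hχ : ∀ p, p ∈ P → _ := fun p hp => exists_chi P d.ico p hp
  choose! χ c1 c2 c3 c4 c5 using hχ
  have b : Bump P χ := ⟨c1, c2, c3, c4, c5⟩
  obtain ⟨M, hM⟩ := (P.image z).bddAbove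
  obtain ⟨N, hN⟩ := (P.image w).bddBelow
  have hM' : ∀ p ∈ P, z p ≤ M := fun p hp => hM (by simpa using ⟨p, hp, rfl⟩)
  have hN' : ∀ p ∈ P, N ≤ w p := fun p hp => hN (by simpa using ⟨p, hp, rfl⟩)
  have gz := good_of_knot d kz
  have gw := good_of_knot d kw
  set w' : ℝ → ℝ := fun t => w t + (M - N + 1) with hw'
  have hlt : ∀ p ∈ P, ∀ q ∈ P, z p < w' q := by
    intro p hp q hq
    have := hM' p hp
    have := hN' q hq
    simp only [hw']
    linarith
  have e1 : V (mkc x y z) = V (mkc x y (zz P χ z)) := by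
    apply same_order hV g d kz.cz kz.pz gz (zz_c b z) (zz_per b z)
    intro p hp q hq _ _ _ h
    rwa [zz_val b z p hp, zz_val b z q hq]
  have e2 : V (mkc x y w) = V (mkc x y (zz P χ w')) := by
    apply same_order hV g d kw.cz kw.pz gw (zz_c b w') (zz_per b w')
    intro p hp q hq _ _ _ h
    rw [zz_val b w' p hp, zz_val b w' q hq]
    simpa [hw'] using h
  set k : Finset ℝ → ℝ → ℝ := fun S q => if q ∈ S then w' q else z q with hk
  have gk : ∀ S, Good P x y (k S) := by
    intro S p hp q hq hne hx hy
    simp only [hk]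
    split_ifs
    · simpa [hw'] using gw p hp q hq hne hx hy
    · exact (hlt q hq p hp).ne'
    · exact (hlt p hp q hq).ne
    · exact gz p hp q hq hne hx hy
  have e3 : ∀ S ⊆ P, V (mkc x y (zz P χ z)) = V (mkc x y (zz P χ (k S))) := by
    intro S
    induction S using Finset.induction_on with
    | empty => intro _; simp [hk]
    | insert p S hpS ih =>
      intro hS
      rw [ih (fun q hq => hS (Finset.mem_insert_of_mem hq))]
      have hu : k (insert p S) = Function.update (k S) p (w' p) := by
        funext q
        by_cases hq : q = p
        · subst hq; simp [hk]
        · simp [hk, hq]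
      have hg := gk (insert p S)
      rw [hu] at hg ⊢
      exact step_one hV ht g d b (gk S) p (hS (Finset.mem_insert_self p S)) _ hg
  have e4 : zz P χ (k P) = zz P χ w' := by
    funext t
    apply Finset.sum_congr rfl
    intro q hq
    simp [hk, hq]
  rw [e1, e2, e3 P subset_rfl, e4]

/-- The region where `y` is large is an arc, cut out by a cosine. -/
def Arc (y : ℝ → ℝ) (t₁ a C : ℝ) : Prop :=
  -1 < a ∧ a < 1 ∧ ∀ t, (a < Real.cos (2 * Real.pi * (t - t₁)) → C < y t) ∧
    (Real.cos (2 * Real.pi * (t - t₁)) ≤ a → y t ≤ C) ∧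
    (Real.cos (2 * Real.pi * (t - t₁)) = a → deriv y t ≠ 0)

lemma exists_arc {y : ℝ → ℝ} (cy : ContDiff ℝ (⊤ : ℕ∞) y) (py : Function.Periodic y 1) (t₀ : ℝ)
    (hmax : ∀ t, (¬ ∃ m : ℤ, t = t₀ + m) → y t < y t₀) (h2 : deriv (deriv y) t₀ < 0) :
    ∃ t₁ a C, Arc y t₁ a C := by
  have cd : ContDiff ℝ (⊤ : ℕ∞) (deriv y) := ((contDiff_infty_iff_deriv (f := y)).1 cy).2
  have cdd : ContDiff ℝ (⊤ : ℕ∞) (deriv (deriv y)) :=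
    ((contDiff_infty_iff_deriv (f := deriv y)).1 cd).2
  have hle : ∀ t, y t ≤ y t₀ := by
    intro t
    by_cases h : ∃ m : ℤ, t = t₀ + m
    · obtain ⟨m, rfl⟩ := h
      rw [per_int py]
    · exact (hmax t h).le
  have d0 : deriv y t₀ = 0 := by
    apply IsLocalMax.deriv_eq_zero
    exact Filter.Eventually.of_forall hle
  obtain ⟨η, hη, hη4, hneg⟩ : ∃ η > 0, η ≤ 1 / 4 ∧
      ∀ t ∈ Set.Icc (t₀ - η) (t₀ + η), deriv (deriv y) t < 0 := by
    have := cdd.continuous.continuousAt.eventually_lt (continuousAt_const (x := t₀) (y := (0 : ℝ))) h2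
    obtain ⟨r, hr, hb⟩ := Metric.eventually_nhds_iff.1 this
    refine ⟨min (r / 2) (1 / 4), by positivity, min_le_right _ _, ?_⟩
    intro t ht
    apply hb
    have := min_le_left (r / 2) (1 / 4 : ℝ)
    rw [Real.dist_eq, abs_lt]
    constructor <;> linarith [ht.1, ht.2]
  have anti : StrictAntiOn (deriv y) (Set.Icc (t₀ - η) (t₀ + η)) :=
    strictAntiOn_of_deriv_neg (convex_Icc _ _) cd.continuous.continuousOn
      (fun t ht => hneg t (interior_subset ht))
  have hpos : ∀ t, t₀ - η ≤ t → t < t₀ → 0 < deriv y t := by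
    intro t h1 h2
    rw [← d0]
    exact anti ⟨h1, by linarith⟩ ⟨by linarith, by linarith⟩ h2
  have hng : ∀ t, t₀ < t → t ≤ t₀ + η → deriv y t < 0 := by
    intro t h1 h2
    rw [← d0]
    exact anti ⟨by linarith, by linarith⟩ ⟨by linarith, h2⟩ h1
  have up : StrictMonoOn y (Set.Icc (t₀ - η) t₀) :=
    strictMonoOn_of_deriv_pos (convex_Icc _ _) cy.continuous.continuousOn (fun t ht => by
      rw [interior_Icc] at ht
      exact hpos t ht.1.le ht.2)
  have down : StrictAntiOn y (Set.Icc t₀ (t₀ + η)) :=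
    strictAntiOn_of_deriv_neg (convex_Icc _ _) cy.continuous.continuousOn (fun t ht => by
      rw [interior_Icc] at ht
      exact hng t ht.1 ht.2.le)
  obtain ⟨t₂, ht₂, hmax₂⟩ := (isCompact_Icc (a := t₀ + η) (b := t₀ + 1 - η)).exists_isMaxOn
    ⟨t₀ + η, by constructor <;> linarith⟩ cy.continuous.continuousOn
  have hout : ∀ t, t₀ + η ≤ t → t ≤ t₀ + 1 - η → y t ≤ y t₂ := fun t h1 h2 => hmax₂ ⟨h1, h2⟩
  have hC0 : y t₂ < y t₀ := by
    apply hmax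
    rintro ⟨m, hm⟩
    have a1 := ht₂.1
    have a2 := ht₂.2
    have h1 : (m : ℝ) < 1 := by linarith
    have h2 : (0 : ℝ) < m := by linarith
    have h3 : m < 1 := by exact_mod_cast h1
    have h4 : 0 < m := by exact_mod_cast h2
    omega
  set C := (y t₂ + y t₀) / 2 with hC
  have hp1 : ∀ t, y (t + 1) = y t := py
  have yl : y (t₀ - η) < C := by
    have := hout (t₀ - η + 1) (by linarith) (by linarith)
    rw [hp1] at this
    linarith
  have yr : y (t₀ + η) < C := by
    have := hout (t₀ + η) (by linarith) (by linarith)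
    linarith
  have ym : C < y t₀ := by linarith
  obtain ⟨α, hα, eα⟩ := intermediate_value_Ioo (by linarith : t₀ - η ≤ t₀)
    cy.continuous.continuousOn ⟨yl, ym⟩
  obtain ⟨β, hβ, eβ⟩ := intermediate_value_Ioo' (by linarith : t₀ ≤ t₀ + η)
    cy.continuous.continuousOn ⟨yr, ym⟩
  obtain ⟨hα1, hα2⟩ := hα
  obtain ⟨hβ1, hβ2⟩ := hβ
  have pi := Real.pi_pos
  set δ := (β - α) / 2 with hδ
  have δ0 : 0 < δ := by linarith
  have δ1 : δ < 1 / 4 := by linarith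
  set t₁ := (α + β) / 2 with ht₁
  have mem : ∀ r, 0 ≤ r → r ≤ 1 / 2 → 2 * Real.pi * r ∈ Set.Icc 0 Real.pi := fun r h1 h2 =>
    ⟨by positivity, by nlinarith⟩
  refine ⟨t₁, Real.cos (2 * Real.pi * δ), C, ?_, ?_, ?_⟩
  · rw [← Real.cos_pi]
    exact Real.strictAntiOn_cos (mem δ δ0.le (by linarith)) ⟨pi.le, le_rfl⟩ (by nlinarith)
  · rw [← Real.cos_zero]
    exact Real.strictAntiOn_cos ⟨le_rfl, pi.le⟩ (mem δ δ0.le (by linarith)) (by positivity)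
  intro t
  obtain ⟨r, m, hr, hrt⟩ : ∃ (r : ℝ) (m : ℤ), |r - t₁| ≤ 1 / 2 ∧ t = r + m := by
    refine ⟨t - round (t - t₁), round (t - t₁), ?_, by ring⟩
    have := abs_sub_round (t - t₁)
    rwa [show t - round (t - t₁) - t₁ = t - t₁ - round (t - t₁) by ring]
  have ey : y t = y r := by rw [hrt, per_int py]
  have pdy : Function.Periodic (deriv y) 1 := by
    intro t
    have : (fun s => y (s + 1)) = y := funext hp1
    rw [← deriv_comp_add_const, this]
  have edy : deriv y t = deriv y r := by rw [hrt, per_int pdy]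
  have ec : Real.cos (2 * Real.pi * (t - t₁)) = Real.cos (2 * Real.pi * |r - t₁|) := by
    have : 2 * Real.pi * (t - t₁) = 2 * Real.pi * (r - t₁) + m * (2 * Real.pi) := by
      rw [hrt]; ring
    rw [this, Real.cos_add_int_mul_two_pi, ← Real.cos_abs, abs_mul,
      abs_of_pos (by positivity : 0 < 2 * Real.pi)]
  have m1 := mem _ (abs_nonneg (r - t₁)) hr
  have m2 := mem δ δ0.le (by linarith)
  have hr2 := abs_le.1 hr
  rw [ey, edy, ec]
  refine ⟨?_, ?_, ?_⟩
  · intro h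
    rw [Real.strictAntiOn_cos.lt_iff_gt m2 m1] at h
    have h' : |r - t₁| < δ := lt_of_mul_lt_mul_left h (by positivity)
    rw [abs_lt] at h'
    rcases le_total r t₀ with hrt | hrt
    · rw [← eα]
      exact up ⟨by linarith, by linarith⟩ ⟨by linarith, by linarith⟩ (by linarith)
    · rw [← eβ]
      exact down ⟨by linarith, by linarith⟩ ⟨by linarith, by linarith⟩ (by linarith)
  · intro h
    rw [Real.strictAntiOn_cos.le_iff_ge m1 m2] at h
    have h' : δ ≤ |r - t₁| := le_of_mul_le_mul_left h (by positivity)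
    rcases le_abs.1 h' with h' | h'
    · rcases le_total r (t₀ + η) with hrt | hrt
      · rw [← eβ]
        exact down.antitoneOn ⟨by linarith, by linarith⟩ ⟨by linarith, by linarith⟩ (by linarith)
      · have := hout r hrt (by linarith [hr2.2])
        linarith
    · rcases le_total (t₀ - η) r with hrt | hrt
      · rw [← eα]
        exact up.monotoneOn ⟨by linarith, by linarith⟩ ⟨by linarith, by linarith⟩ (by linarith)
      · have := hout (r + 1) (by linarith [hr2.1]) (by linarith)
        rw [hp1] at this
        linarith
  · intro h
    have h1 := Real.injOn_cos m1 m2 h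
    have h' : |r - t₁| = δ := mul_left_cancel₀ (by positivity) h1
    rcases (abs_eq δ0.le).1 h' with h' | h'
    · have : r = β := by linarith
      rw [this]
      exact (hng β hβ1 hβ2.le).ne
    · have : r = α := by linarith
      rw [this]
      exact (hpos α hα1.le hα2).ne'

lemma exists_shear {V : (ℝ → E3) → ℝ} (hV : IsKnotInvariant V) {x y z : ℝ → ℝ}
    (g : Gen x y) (k : Knot3 x y z) :
    ∃ y', Gen x y' ∧ Knot3 x y' z ∧ V (mkc x y z) = V (mkc x y' z) ∧ ∃ t₁ a C, Arc y' t₁ a C := by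
  obtain ⟨cx, cy, px, py, gimm, gtr⟩ := g
  have cz := k.cz
  have dx := smooth_diff cx
  have dy := smooth_diff cy
  obtain ⟨t₀, -, hm⟩ := (isCompact_Icc (a := (0 : ℝ)) (b := 1)).exists_isMaxOn
    ⟨0, by simp⟩ cy.continuous.continuousOn
  have hle : ∀ t, y t ≤ y t₀ := by
    intro t
    obtain ⟨m, hm'⟩ := fract_shift t
    have : y (Int.fract t) ≤ y t₀ := hm ⟨Int.fract_nonneg t, (Int.fract_lt_one t).le⟩
    rwa [hm', per_int py] at this
  have dmax : ∀ t, y t = y t₀ → deriv y t = 0 := by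
    intro t e
    apply IsLocalMax.deriv_eq_zero
    refine Filter.Eventually.of_forall fun s => ?_
    rw [e]
    exact hle s
  set Y : ℝ → ℝ → ℝ := fun l t => y t - l * (x t - x t₀) ^ 2 with hY
  have D : ∀ l t, HasDerivAt (Y l) (deriv y t - 2 * l * (x t - x t₀) * deriv x t) t := by
    intro l t
    have := (dy t).sub ((((dx t).sub_const (x t₀)).pow 2).const_mul l)
    refine this.congr_deriv ?_
    simp
    ring
  have yeq : ∀ l s t, x s = x t → Y l s = Y l t → y s = y t := by
    intro l s t e1 e2
    simp only [hY, e1] at e2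
    linarith
  have cY : ∀ l, ContDiff ℝ (⊤ : ℕ∞) (Y l) := fun l => by simp only [hY]; fun_prop
  have pY : ∀ l, Function.Periodic (Y l) 1 := fun l t => by simp [hY, px t, py t]
  have kY : ∀ l, Knot3 x (Y l) z := by
    intro l
    refine ⟨cx, cY l, cz, px, pY l, k.pz, ?_, ?_⟩
    · intro s t e1 e2 e3
      exact k.inj s t e1 (yeq l s t e1 e2) e3
    · intro t e1 e2
      rw [(D l t).deriv, e1] at e2
      exact absurd (by linarith) (gimm t e1)
  have gY : Gen x (Y 1) := by
    refine ⟨cx, cY 1, px, pY 1, ?_, ?_⟩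
    · intro t e1 e2
      rw [(D 1 t).deriv, e1] at e2
      exact absurd (by linarith) (gimm t e1)
    · intro s t e1 e2
      rcases gtr s t e1 (yeq 1 s t e1 e2) with h | h
      · exact Or.inl h
      · right
        rw [(D 1 t).deriv, (D 1 s).deriv, e1]
        intro h'
        apply h
        linear_combination h'
  refine ⟨Y 1, gY, kY 1, ?_, ?_⟩
  · have := iso_eq hV (fun _ => x) Y (fun _ => z) (by fun_prop) (by simp only [hY]; fun_prop)
      (by fun_prop) (fun l _ => kY l)
    rw [← this]
    congr 2
    funext t
    simp [hY]
  · apply exists_arc (cY 1) (pY 1) t₀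
    · intro t hnm
      have h1 : Y 1 t₀ = y t₀ := by simp [hY]
      rw [h1]
      have h2 := hle t
      have h3 := sq_nonneg (x t - x t₀)
      rcases (by simp only [hY]; linarith : Y 1 t ≤ y t₀).lt_or_eq with h | h
      · exact h
      · exfalso
        simp only [hY] at h
        have e1 : y t = y t₀ := by linarith
        have e2 : x t = x t₀ := by
          have : (x t - x t₀) ^ 2 = 0 := by linarith
          have := pow_eq_zero_iff (two_ne_zero) |>.1 this
          linarith
        rcases gtr t t₀ e2 e1 with h | h
        · exact hnm h
        · rw [dmax t e1, dmax t₀ rfl] at h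
          simp at h
    · have cdy : ContDiff ℝ (⊤ : ℕ∞) (deriv y) := ((contDiff_infty_iff_deriv (f := y)).1 cy).2
      have cdx : ContDiff ℝ (⊤ : ℕ∞) (deriv x) := ((contDiff_infty_iff_deriv (f := x)).1 cx).2
      have hyy : deriv (deriv y) t₀ ≤ 0 := by
        by_contra hc
        push Not at hc
        have hmin := isLocalMin_of_deriv_deriv_pos hc (dmax t₀ rfl) cy.continuous.continuousAt
        have hconst : y =ᶠ[𝓝 t₀] fun _ => y t₀ := by
          filter_upwards [hmin] with t ht using le_antisymm (hle t) ht
        have := hconst.deriv.deriv_eq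
        simp at this
        linarith
      have hx0 : deriv x t₀ ≠ 0 := fun h => gimm t₀ h (dmax t₀ rfl)
      have e : deriv (Y 1) = fun t => deriv y t - 2 * 1 * (x t - x t₀) * deriv x t :=
        funext fun t => (D 1 t).deriv
      rw [e]
      have H := (smooth_diff cdy t₀).sub
        ((((dx t₀).sub_const (x t₀)).const_mul (2 * 1)).mul (smooth_diff cdx t₀))
      have H' := H.deriv
      have H2 : deriv (fun t => deriv y t - 2 * 1 * (x t - x t₀) * deriv x t) t₀ = _ := H'
      rw [H2]
      have : 0 < deriv x t₀ ^ 2 := by positivity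
      simp
      nlinarith

lemma alg_key {a w c₁ s₁ c₂ s₂ : ℝ} (ha : a ^ 2 < 1) (h1 : c₁ ^ 2 + s₁ ^ 2 = 1)
    (h2 : c₂ ^ 2 + s₂ ^ 2 = 1) (e1 : s₁ = w * (1 - a * c₁)) (e2 : s₂ = w * (1 - a * c₂))
    (hp : 0 ≤ (c₁ - a) * (c₂ - a)) (d1 : 1 - a * c₁ ≠ 0) (d2 : 1 - a * c₂ ≠ 0) : c₁ = c₂ := by
  by_contra hne
  have hsum : (1 + w ^ 2 * a ^ 2) * (c₁ + c₂) = 2 * w ^ 2 * a := by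
    apply mul_left_cancel₀ (sub_ne_zero.2 hne)
    rw [e1] at h1
    rw [e2] at h2
    linear_combination h1 - h2
  have hK : 0 < 1 + w ^ 2 * a ^ 2 := by positivity
  have hprod : (1 + w ^ 2 * a ^ 2) * ((c₁ - a) * (c₂ - a)) =
      (1 - a ^ 2) * (w ^ 2 * (1 - a ^ 2) - 1) := by
    rw [e1] at h1
    linear_combination (c₁ - a) * hsum - h1
  have k1 : (1 - a * c₁) ^ 2 * (w ^ 2 * (1 - a ^ 2) - 1) = -(c₁ - a) ^ 2 := by
    have : s₁ ^ 2 = w ^ 2 * (1 - a * c₁) ^ 2 := by rw [e1]; ring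
    linear_combination (1 - a ^ 2) * h1 - (1 - a ^ 2) * this
  have k2 : (1 - a * c₂) ^ 2 * (w ^ 2 * (1 - a ^ 2) - 1) = -(c₂ - a) ^ 2 := by
    have : s₂ ^ 2 = w ^ 2 * (1 - a * c₂) ^ 2 := by rw [e2]; ring
    linear_combination (1 - a ^ 2) * h2 - (1 - a ^ 2) * this
  have hq : 0 ≤ w ^ 2 * (1 - a ^ 2) - 1 := by
    have h3 : 0 ≤ (1 - a ^ 2) * (w ^ 2 * (1 - a ^ 2) - 1) := by
      rw [← hprod]; positivity
    exact nonneg_of_mul_nonneg_right h3 (by linarith)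
  have z1 : c₁ - a = 0 := by
    have : (c₁ - a) ^ 2 ≤ 0 := by
      have := mul_nonneg (sq_nonneg (1 - a * c₁)) hq
      linarith
    exact pow_eq_zero_iff two_ne_zero |>.1 (le_antisymm this (sq_nonneg _))
  have z2 : c₂ - a = 0 := by
    have : (c₂ - a) ^ 2 ≤ 0 := by
      have := mul_nonneg (sq_nonneg (1 - a * c₂)) hq
      linarith
    exact pow_eq_zero_iff two_ne_zero |>.1 (le_antisymm this (sq_nonneg _))
  exact hne (by linarith)

/-- Shifted cosine. -/
noncomputable def cc (t₁ t : ℝ) : ℝ := Real.cos (2 * Real.pi * (t - t₁))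
/-- Shifted sine. -/
noncomputable def ss (t₁ t : ℝ) : ℝ := Real.sin (2 * Real.pi * (t - t₁))

lemma cc_smooth (t₁ : ℝ) : ContDiff ℝ (⊤ : ℕ∞) (cc t₁) :=
  Real.contDiff_cos.comp (by fun_prop)

lemma ss_smooth (t₁ : ℝ) : ContDiff ℝ (⊤ : ℕ∞) (ss t₁) :=
  Real.contDiff_sin.comp (by fun_prop)

lemma cc_per (t₁ : ℝ) : Function.Periodic (cc t₁) 1 := fun t => by
  rw [cc, cc, show 2 * Real.pi * (t + 1 - t₁) = 2 * Real.pi * (t - t₁) + 2 * Real.pi by ring,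
    Real.cos_add_two_pi]

lemma ss_per (t₁ : ℝ) : Function.Periodic (ss t₁) 1 := fun t => by
  rw [ss, ss, show 2 * Real.pi * (t + 1 - t₁) = 2 * Real.pi * (t - t₁) + 2 * Real.pi by ring,
    Real.sin_add_two_pi]

lemma cc_der (t₁ t : ℝ) : HasDerivAt (cc t₁) (-(2 * Real.pi) * ss t₁ t) t := by
  have := (((hasDerivAt_id t).sub_const t₁).const_mul (2 * Real.pi)).cos
  refine this.congr_deriv ?_
  simp [ss]
  ring

lemma ss_der (t₁ t : ℝ) : HasDerivAt (ss t₁) (2 * Real.pi * cc t₁ t) t := by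
  have := (((hasDerivAt_id t).sub_const t₁).const_mul (2 * Real.pi)).sin
  refine this.congr_deriv ?_
  simp [cc]
  ring

lemma cs_one (t₁ t : ℝ) : cc t₁ t ^ 2 + ss t₁ t ^ 2 = 1 := Real.cos_sq_add_sin_sq _

lemma cs_inj (t₁ s t : ℝ) (h1 : cc t₁ s = cc t₁ t) (h2 : ss t₁ s = ss t₁ t) :
    ∃ m : ℤ, s = t + m := by
  have : Real.cos (2 * Real.pi * (s - t₁) - 2 * Real.pi * (t - t₁)) = 1 := by
    rw [Real.cos_sub]
    change cc t₁ s * cc t₁ t + ss t₁ s * ss t₁ t = 1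
    rw [h1, h2]
    linarith [cs_one t₁ t]
  obtain ⟨n, hn⟩ := (Real.cos_eq_one_iff _).1 this
  refine ⟨n, ?_⟩
  have pi := Real.pi_pos
  have : (2 * Real.pi) * (n : ℝ) = (2 * Real.pi) * (s - t) := by linarith
  have := mul_left_cancel₀ (by positivity) this
  linarith

lemma unknot {V : (ℝ → E3) → ℝ} (hV : IsKnotInvariant V) (ht : Type0 V) {x y z : ℝ → ℝ}
    (g : Gen x y) (k : Knot3 x y z) {t₁ a C : ℝ} (h : Arc y t₁ a C) :
    V (mkc x y z) = V (mkc (cc 0) (ss 0) (fun _ => 0)) := by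
  obtain ⟨ha1, ha2, harc⟩ := h
  have pi := Real.pi_pos
  have ha : a ^ 2 < 1 := by nlinarith
  have hden : ∀ t, 0 < 1 - a * cc t₁ t := by
    intro t
    have h1 := Real.neg_one_le_cos (2 * Real.pi * (t - t₁))
    have h2 := Real.cos_le_one (2 * Real.pi * (t - t₁))
    change -1 ≤ cc t₁ t at h1
    change cc t₁ t ≤ 1 at h2
    nlinarith [sq_nonneg (a - cc t₁ t)]
  have cx := k.cx
  have cy := k.cy
  have cC := cc_smooth t₁
  have cS := ss_smooth t₁
  set w : ℝ → ℝ := fun t => ss t₁ t / (1 - a * cc t₁ t) with hw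
  have cw : ContDiff ℝ (⊤ : ℕ∞) w := cS.div (by fun_prop) (fun t => (hden t).ne')
  have pw : Function.Periodic w 1 := fun t => by simp [hw, ss_per t₁ t, cc_per t₁ t]
  have dw : ∀ t, deriv w t = 2 * Real.pi * (cc t₁ t - a) / (1 - a * cc t₁ t) ^ 2 := by
    intro t
    have := (ss_der t₁ t).div (((cc_der t₁ t).const_mul a).const_sub 1) (hden t).ne'
    have e : deriv w t = _ := this.deriv
    rw [e]
    congr 1
    linear_combination -(2 * Real.pi * a) * cs_one t₁ t
  have dw0 : ∀ t, deriv w t = 0 → cc t₁ t = a := by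
    intro t e
    rw [dw, div_eq_zero_iff] at e
    rcases e with e | e
    · have := (mul_eq_zero.1 e).resolve_left (by positivity)
      linarith
    · exact absurd e (pow_ne_zero 2 (hden t).ne')
  have sw : ∀ t, ss t₁ t = w t * (1 - a * cc t₁ t) := fun t => by
    simp only [hw]
    rw [div_mul_cancel₀ _ (hden t).ne']
  have inj1 : ∀ s t, y s = y t → w s = w t → ∃ m : ℤ, s = t + m := by
    intro s t e1 e2
    have s1 := sw s
    have s2 := sw t
    rw [e2] at s1
    have hp : 0 ≤ (cc t₁ s - a) * (cc t₁ t - a) := by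
      obtain ⟨A1, A2, -⟩ := harc s
      obtain ⟨B1, B2, -⟩ := harc t
      change a < cc t₁ s → C < y s at A1
      change cc t₁ s ≤ a → y s ≤ C at A2
      change a < cc t₁ t → C < y t at B1
      change cc t₁ t ≤ a → y t ≤ C at B2
      rcases lt_or_ge a (cc t₁ s) with p | p <;> rcases lt_or_ge a (cc t₁ t) with q | q
      · exact mul_nonneg (by linarith) (by linarith)
      · linarith [A1 p, B2 q]
      · linarith [A2 p, B1 q]
      · exact mul_nonneg_of_nonpos_of_nonpos (by linarith) (by linarith)
    have ec := alg_key ha (cs_one t₁ s) (cs_one t₁ t) s1 s2 hp (hden s).ne' (hden t).ne'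
    exact cs_inj t₁ s t ec (by rw [s1, s2, ec])
  have K1 : ∀ u : ℝ → ℝ, ContDiff ℝ (⊤ : ℕ∞) u → Function.Periodic u 1 → Knot3 u y w :=
    fun u cu pu => ⟨cu, cy, cw, pu, k.py, pw, fun s t _ e1 e2 => inj1 s t e1 e2,
      fun t _ e1 e2 => (harc t).2.2 (dw0 t e2) e1⟩
  have K2 : ∀ u : ℝ → ℝ, ContDiff ℝ (⊤ : ℕ∞) u → Function.Periodic u 1 → Knot3 (cc t₁) u w := by
    intro u cu pu
    refine ⟨cC, cu, cw, cc_per t₁, pu, pw, ?_, ?_⟩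
    · intro s t e1 _ e2
      exact cs_inj t₁ s t e1 (by rw [sw s, sw t, e1, e2])
    · intro t e1 _ e2
      rw [(cc_der t₁ t).deriv] at e1
      have e1' : ss t₁ t = 0 := (mul_eq_zero.1 e1).resolve_left (by linarith)
      have := cs_one t₁ t
      rw [e1', dw0 t e2] at this
      linarith
  have K3 : ∀ r, ∀ u : ℝ → ℝ, ContDiff ℝ (⊤ : ℕ∞) u → Function.Periodic u 1 →
      Knot3 (cc r) (ss r) u := by
    intro r u cu pu
    refine ⟨cc_smooth r, ss_smooth r, cu, cc_per r, ss_per r, pu,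
      fun s t e1 e2 _ => cs_inj r s t e1 e2, ?_⟩
    intro t e1 e2
    rw [(cc_der r t).deriv] at e1
    rw [(ss_der r t).deriv] at e2
    have e1' : ss r t = 0 := (mul_eq_zero.1 e1).resolve_left (by linarith)
    have e2' : cc r t = 0 := (mul_eq_zero.1 e2).resolve_left (by linarith)
    have := cs_one r t
    rw [e1', e2'] at this
    norm_num at this
  have E0 : V (mkc x y z) = V (mkc x y w) := change_z hV ht g k (K1 x cx k.px)
  have E1 : V (mkc x y w) = V (mkc (cc t₁) y w) := by
    have := iso_eq hV (fun l t => (1 - l) * x t + l * cc t₁ t) (fun _ => y) (fun _ => w)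
      (by fun_prop) (by fun_prop) (by fun_prop)
      (fun l _ => K1 _ (by fun_prop) (fun t => by simp [k.px t, cc_per t₁ t]))
    simpa using this
  have E2 : V (mkc (cc t₁) y w) = V (mkc (cc t₁) (ss t₁) w) := by
    have := iso_eq hV (fun _ => cc t₁) (fun l t => (1 - l) * y t + l * ss t₁ t) (fun _ => w)
      (by fun_prop) (by fun_prop) (by fun_prop)
      (fun l _ => K2 _ (by fun_prop) (fun t => by simp [k.py t, ss_per t₁ t]))
    simpa using this
  have E3 : V (mkc (cc t₁) (ss t₁) w) = V (mkc (cc t₁) (ss t₁) (fun _ => 0)) := by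
    have := iso_eq hV (fun _ => cc t₁) (fun _ => ss t₁) (fun l t => (1 - l) * w t)
      (by fun_prop) (by fun_prop) (by fun_prop)
      (fun l _ => K3 t₁ _ (by fun_prop) (fun t => by simp [pw t]))
    simpa using this
  have E4 : V (mkc (cc 0) (ss 0) (fun _ => 0)) = V (mkc (cc t₁) (ss t₁) (fun _ => 0)) := by
    have := iso_eq hV (fun l => cc (l * t₁)) (fun l => ss (l * t₁)) (fun _ _ => 0)
      (Real.contDiff_cos.comp (by fun_prop)) (Real.contDiff_sin.comp (by fun_prop))
      (by fun_prop) (fun l _ => K3 _ _ (by fun_prop) (fun t => rfl))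
    simpa using this
  rw [E0, E1, E2, E3, E4]

lemma all_unknot {V : (ℝ → E3) → ℝ} (hV : IsKnotInvariant V) (ht : Type0 V) (K : ℝ → E3)
    (hK : IsKnot K) : V K = V (mkc (cc 0) (ss 0) (fun _ => 0)) := by
  obtain ⟨x, y, z, rfl, k⟩ := hK.knot3
  obtain ⟨a, b, g⟩ := exists_generic k
  have cx := k.cx
  have cy := k.cy
  have cz := k.cz
  have dx := smooth_diff cx
  have dy := smooth_diff cy
  have dz := smooth_diff cz
  have kl : ∀ l : ℝ, Knot3 (fun t => x t - l * a * z t) (fun t => y t - l * b * z t) z := by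
    intro l
    refine ⟨by fun_prop, by fun_prop, cz, fun t => by simp [k.px t, k.pz t],
      fun t => by simp [k.py t, k.pz t], k.pz, ?_, ?_⟩
    · intro s t e1 e2 e3
      simp only [e3] at e1 e2
      exact k.inj s t (by linarith) (by linarith) e3
    · intro t e1 e2 e3
      have f1 : deriv (fun t => x t - l * a * z t) t = _ := ((dx t).sub ((dz t).const_mul (l * a))).deriv
      have f2 : deriv (fun t => y t - l * b * z t) t = _ := ((dy t).sub ((dz t).const_mul (l * b))).deriv
      rw [f1, e3] at e1
      rw [f2, e3] at e2
      exact k.imm t (by linarith) (by linarith) e3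
  have E : V (mkc x y z) = V (mkc (fun t => x t - a * z t) (fun t => y t - b * z t) z) := by
    have := iso_eq hV (fun l t => x t - l * a * z t) (fun l t => y t - l * b * z t) (fun _ => z)
      (by fun_prop) (by fun_prop) (by fun_prop) (fun l _ => kl l)
    simpa using this
  have k' := kl 1
  simp only [one_mul] at k'
  obtain ⟨y', g', k'', E', t₁, c, C, harc⟩ := exists_shear hV g k'
  rw [E, E', unknot hV ht g' k'' harc]

/-- **Every knot invariant of finite type 0 is constant** (§5 of the paper): if a knot
invariant `V` takes equal values on the two resolutions of any single transverse double
point, then `V` takes the same value on all knots. -/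
theorem finite_type_zero_invariant_is_constant
    (V : (ℝ → E3) → ℝ) (hV : IsKnotInvariant V)
    (htype0 : ∀ (F : ℝ → E3) (s t : ℝ) (φ : ℝ → ℝ) (ε : ℝ),
      ContDiff ℝ (⊤ : ℕ∞) F → Function.Periodic F 1 → (∀ x, deriv F x ≠ 0) →
      s ∈ Set.Ico (0 : ℝ) 1 → t ∈ Set.Ico (0 : ℝ) 1 → s ≠ t → F s = F t →
      (∀ x ∈ Set.Ico (0 : ℝ) 1, ∀ y ∈ Set.Ico (0 : ℝ) 1, F x = F y →
        x = y ∨ (x = s ∧ y = t) ∨ (x = t ∧ y = s)) →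
      LinearIndependent ℝ ![deriv F s, deriv F t] →
      ContDiff ℝ (⊤ : ℕ∞) φ → Function.Periodic φ 1 → φ t = 1 →
      (∀ x : ℝ, φ x ≠ 0 → ¬ ∃ m : ℤ, x = s + m) →
      0 < ε →
      IsKnot (fun x => F x + ε • (φ x • cross3 (deriv F s) (deriv F t))) →
      IsKnot (fun x => F x - ε • (φ x • cross3 (deriv F s) (deriv F t))) →
      V (fun x => F x + ε • (φ x • cross3 (deriv F s) (deriv F t))) =
        V (fun x => F x - ε • (φ x • cross3 (deriv F s) (deriv F t)))) :
    ∀ K₁ K₂ : ℝ → E3, IsKnot K₁ → IsKnot K₂ → V K₁ = V K₂ := by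
  intro K₁ K₂ h₁ h₂
  rw [all_unknot hV htype0 K₁ h₁, all_unknot hV htype0 K₂ h₂]
end
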